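/- arXiv:2402.09853 — 2 statements merged into one kernel-verified Lean document; each statement's English description precedes it below -/
import Mathlib

section
/- Let α(z) = Σ_{j≥0} α_j z^j be a holomorphic function on the unit disc 𝔻. The Hankel matrix Γ_α = {α_{j+k}}_{j,k≥0} defines a trace class operator (class S_1) on ℓ² if and only if ∫_𝔻 |α''(ζ)| dm₂(ζ) < ∞, where α'' is the second complex derivative of α and m₂ is planar Lebesgue measure. -/
open MeasureTheory Complex Real

noncomputable section

/-- ℓ² of ℕ over ℂ. -/
abbrev l2 : Type := lp (fun _ : ℕ => ℂ) 2

/-- The `j`-th singular value of a bounded operator on ℓ²: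
`s_j(T) = inf {‖T − R‖ : rank R ≤ j}`. -/
noncomputable def sVal (T : l2 →L[ℂ] l2) (j : ℕ) : ℝ :=
  sInf {c : ℝ | ∃ R : l2 →L[ℂ] l2,
    Module.rank ℂ (LinearMap.range (R : l2 →ₗ[ℂ] l2)) ≤ (j : Cardinal) ∧ c = ‖T - R‖}

/-- Membership in the trace class `S_1`: `Σ_j s_j(T) < ∞`. -/
def MemTraceClass (T : l2 →L[ℂ] l2) : Prop :=
  Summable fun j : ℕ => sVal T j


lemma sVal_bddBelow (T : l2 →L[ℂ] l2) (j : ℕ) : BddBelow {c : ℝ | ∃ R : l2 →L[ℂ] l2,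
    Module.rank ℂ (LinearMap.range (R : l2 →ₗ[ℂ] l2)) ≤ (j : Cardinal) ∧ c = ‖T - R‖} :=
  ⟨0, by rintro c ⟨R, -, rfl⟩; exact norm_nonneg _⟩

lemma sVal_nonempty (T : l2 →L[ℂ] l2) (j : ℕ) : {c : ℝ | ∃ R : l2 →L[ℂ] l2,
    Module.rank ℂ (LinearMap.range (R : l2 →ₗ[ℂ] l2)) ≤ (j : Cardinal) ∧ c = ‖T - R‖}.Nonempty :=
  ⟨‖T - 0‖, 0, by simp, rfl⟩

lemma sVal_le (T R : l2 →L[ℂ] l2) (j : ℕ)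
    (hR : (R : l2 →ₗ[ℂ] l2).rank ≤ (j : Cardinal)) : sVal T j ≤ ‖T - R‖ :=
  csInf_le (sVal_bddBelow T j) ⟨R, hR, rfl⟩

lemma sVal_nonneg (T : l2 →L[ℂ] l2) (j : ℕ) : 0 ≤ sVal T j :=
  Real.sInf_nonneg (by rintro c ⟨R, -, rfl⟩; exact norm_nonneg _)

lemma sVal_antitone (T : l2 →L[ℂ] l2) : Antitone (sVal T) := by
  intro i j hij
  refine csInf_le_csInf (sVal_bddBelow T j) (sVal_nonempty T i) ?_
  rintro c ⟨R, hR, rfl⟩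
  exact ⟨R, hR.trans (by exact_mod_cast hij), rfl⟩

lemma exists_approx (T : l2 →L[ℂ] l2) (j : ℕ) {ε : ℝ} (hε : 0 < ε) :
    ∃ R : l2 →L[ℂ] l2, (R : l2 →ₗ[ℂ] l2).rank ≤ (j : Cardinal) ∧ ‖T - R‖ ≤ sVal T j + ε := by
  obtain ⟨c, ⟨R, hR, rfl⟩, h⟩ := Real.lt_sInf_add_pos (sVal_nonempty T j) hε
  exact ⟨R, hR, h.le⟩

lemma rank_starProjection_span {n : ℕ} (e : Fin n → l2)
    [(Submodule.span ℂ (Set.range e)).HasOrthogonalProjection] :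
    ((Submodule.span ℂ (Set.range e)).starProjection : l2 →ₗ[ℂ] l2).rank ≤ (n : Cardinal) := by
  have h1 : LinearMap.range ((Submodule.span ℂ (Set.range e)).starProjection : l2 →ₗ[ℂ] l2)
      ≤ Submodule.span ℂ (Set.range e) := by
    rintro _ ⟨x, rfl⟩
    exact Submodule.starProjection_apply_mem _ _
  refine (Submodule.rank_mono h1).trans ((rank_span_le _).trans ?_)
  simpa using Cardinal.mk_range_le (f := e)

lemma greedy_step (T : l2 →L[ℂ] l2) (n : ℕ) (hpos : 0 < sVal T (2 * n)) (e f : Fin n → l2) :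
    ∃ u v : l2, ‖u‖ = 1 ∧ ‖v‖ = 1 ∧ (∀ i, inner ℂ (e i) u = 0) ∧ (∀ i, inner ℂ (f i) v = 0) ∧
      sVal T (2 * n) / 2 ≤ ‖inner ℂ u (T v)‖ := by
  have : FiniteDimensional ℂ (Submodule.span ℂ (Set.range e)) :=
    FiniteDimensional.span_of_finite _ (Set.finite_range _)
  have : FiniteDimensional ℂ (Submodule.span ℂ (Set.range f)) :=
    FiniteDimensional.span_of_finite _ (Set.finite_range _)
  set E := Submodule.span ℂ (Set.range e) with hE
  set F := Submodule.span ℂ (Set.range f) with hF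
  set A : l2 →L[ℂ] l2 := Eᗮ.starProjection ∘L T ∘L Fᗮ.starProjection with hA
  have hrank : ((T - A : l2 →L[ℂ] l2) : l2 →ₗ[ℂ] l2).rank ≤ ((2 * n : ℕ) : Cardinal) := by
    have hdec : ((T - A : l2 →L[ℂ] l2) : l2 →ₗ[ℂ] l2)
        = (E.starProjection : l2 →ₗ[ℂ] l2) ∘ₗ (T : l2 →ₗ[ℂ] l2)
          + ((Eᗮ.starProjection ∘L T : l2 →L[ℂ] l2) : l2 →ₗ[ℂ] l2) ∘ₗ
            (F.starProjection : l2 →ₗ[ℂ] l2) := by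
      ext1 x
      simp [hA, Submodule.starProjection_orthogonal]
      abel
    rw [hdec]
    refine (LinearMap.rank_add_le _ _).trans ?_
    have h1 := (LinearMap.rank_comp_le_left (T : l2 →ₗ[ℂ] l2)
      (E.starProjection : l2 →ₗ[ℂ] l2)).trans (rank_starProjection_span e)
    have h2 := (LinearMap.rank_comp_le_right (F.starProjection : l2 →ₗ[ℂ] l2)
      ((Eᗮ.starProjection ∘L T : l2 →L[ℂ] l2) : l2 →ₗ[ℂ] l2)).trans (rank_starProjection_span f)
    refine (add_le_add h1 h2).trans (le_of_eq ?_)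
    push_cast; ring
  have hs : sVal T (2 * n) ≤ ‖A‖ := by
    have := sVal_le T (T - A) (2 * n) hrank
    simpa using this
  obtain ⟨x, hx⟩ : ∃ x, sVal T (2 * n) / 2 * ‖x‖ < ‖A x‖ := by
    by_contra! h
    have := ContinuousLinearMap.opNorm_le_bound A (by positivity) h
    linarith
  set p := Fᗮ.starProjection x with hp
  set y := A x with hy
  have hyE : y ∈ Eᗮ := Submodule.starProjection_apply_mem _ _
  have hpF : p ∈ Fᗮ := Submodule.starProjection_apply_mem _ _
  have hy0 : 0 < ‖y‖ := lt_of_le_of_lt (by positivity) hx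
  have hp0 : 0 < ‖p‖ := by
    rw [norm_pos_iff]
    rintro h
    have : y = 0 := by simp [hy, hA, ← hp, h]
    simp [this] at hy0
  have hpx : ‖p‖ ≤ ‖x‖ := Submodule.norm_starProjection_apply_le _ _
  have hin : inner ℂ y (T p) = (‖y‖ : ℂ) ^ 2 := by
    have h0 : inner ℂ y y = (‖y‖ : ℂ) ^ 2 := inner_self_eq_norm_sq_to_K y
    rw [← h0]
    have h1 : Eᗮ.starProjection y = y := Submodule.starProjection_eq_self_iff.2 hyE
    conv_lhs => rw [← h1]
    rw [Submodule.inner_starProjection_left_eq_right]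
    rfl
  refine ⟨(‖y‖⁻¹ : ℂ) • y, (‖p‖⁻¹ : ℂ) • p, ?_, ?_, ?_, ?_, ?_⟩
  · rw [norm_smul]; simp [hy0.ne']
  · rw [norm_smul]; simp [hp0.ne']
  · intro i
    rw [inner_smul_right, (Submodule.mem_orthogonal _ _).1 hyE (e i) (Submodule.subset_span ⟨i, rfl⟩), mul_zero]
  · intro i
    rw [inner_smul_right, (Submodule.mem_orthogonal _ _).1 hpF (f i) (Submodule.subset_span ⟨i, rfl⟩), mul_zero]
  · rw [map_smul, inner_smul_left, inner_smul_right, hin]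
    simp only [norm_mul, norm_inv, map_inv₀, RCLike.norm_conj, norm_pow, Complex.norm_real, norm_norm]
    have : ‖y‖⁻¹ * (‖p‖⁻¹ * ‖y‖ ^ 2) = ‖y‖ / ‖p‖ := by field_simp
    rw [this, le_div_iff₀ hp0]
    refine le_trans ?_ hx.le
    gcongr

lemma orthonormal_snoc {n : ℕ} {e : Fin n → l2} (he : Orthonormal ℂ e) {u : l2} (hu : ‖u‖ = 1)
    (h : ∀ i, inner ℂ (e i) u = 0) : Orthonormal ℂ (Fin.snoc e u : Fin (n + 1) → l2) := by
  rw [orthonormal_iff_ite] at he ⊢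
  intro i j
  induction i using Fin.lastCases with
  | last =>
    induction j using Fin.lastCases with
    | last => simp [inner_self_eq_norm_sq_to_K, hu]
    | cast j =>
      have : inner ℂ u (e j) = 0 := inner_eq_zero_symm.1 (h j)
      simp [this, (Fin.castSucc_lt_last j).ne']
  | cast i =>
    induction j using Fin.lastCases with
    | last => simp [h i, (Fin.castSucc_lt_last i).ne]
    | cast j => simp [he i j]

/-- Bounded diagonal sums against orthonormal systems. -/
def Nuc (T : l2 →L[ℂ] l2) : Prop :=
  ∃ M : ℝ, ∀ (n : ℕ) (e f : Fin n → l2), Orthonormal ℂ e → Orthonormal ℂ f →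
    ∑ i, ‖inner ℂ (e i) (T (f i))‖ ≤ M

lemma Nuc.add {S T : l2 →L[ℂ] l2} (hS : Nuc S) (hT : Nuc T) : Nuc (S + T) := by
  obtain ⟨M, hM⟩ := hS
  obtain ⟨N, hN⟩ := hT
  refine ⟨M + N, fun n e f he hf => ?_⟩
  refine le_trans ?_ (add_le_add (hM n e f he hf) (hN n e f he hf))
  rw [← Finset.sum_add_distrib]
  refine Finset.sum_le_sum fun i _ => ?_
  rw [add_apply, inner_add_right]
  exact norm_add_le _ _

lemma rankOne_diag_le (x y : l2) {n : ℕ} {e f : Fin n → l2} (he : Orthonormal ℂ e)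
    (hf : Orthonormal ℂ f) :
    ∑ i, ‖inner ℂ (e i) (InnerProductSpace.rankOne ℂ x y (f i))‖ ≤ ‖x‖ * ‖y‖ := by
  have h1 : ∀ i, ‖inner ℂ (e i) (InnerProductSpace.rankOne ℂ x y (f i))‖
      = ‖inner ℂ (e i) x‖ * ‖inner ℂ (f i) y‖ := by
    intro i
    rw [InnerProductSpace.rankOne_apply, inner_smul_right, norm_mul, norm_inner_symm y, mul_comm]
  simp_rw [h1]
  have h2 := he.sum_inner_products_le x (s := Finset.univ)
  have h3 := hf.sum_inner_products_le y (s := Finset.univ)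
  have h4 := Finset.sum_mul_sq_le_sq_mul_sq Finset.univ (fun i => ‖inner ℂ (e i) x‖)
    (fun i => ‖inner ℂ (f i) y‖)
  refine abs_le_of_sq_le_sq' ?_ (by positivity) |>.2
  refine h4.trans ?_
  rw [mul_pow]
  gcongr

lemma Nuc.rankOne (x y : l2) : Nuc (InnerProductSpace.rankOne ℂ x y) :=
  ⟨‖x‖ * ‖y‖, fun _ _ _ he hf => rankOne_diag_le x y he hf⟩

lemma Nuc.memTraceClass {T : l2 →L[ℂ] l2} (hT : Nuc T) : MemTraceClass T := by
  unfold MemTraceClass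
  by_cases h0 : ∃ N, sVal T N = 0
  · obtain ⟨N, hN⟩ := h0
    refine summable_of_ne_finset_zero (s := Finset.range N) fun j hj => ?_
    have hj' : N ≤ j := by simpa using hj
    exact le_antisymm (hN ▸ sVal_antitone T hj') (sVal_nonneg T j)
  push Not at h0
  have hpos : ∀ j, 0 < sVal T j := fun j => lt_of_le_of_ne (sVal_nonneg T j) (h0 j).symm
  obtain ⟨M, hM⟩ := hT
  have key : ∀ n : ℕ, ∃ e f : Fin n → l2, Orthonormal ℂ e ∧ Orthonormal ℂ f ∧
      ∀ i : Fin n, sVal T (2 * i) / 2 ≤ ‖inner ℂ (e i) (T (f i))‖ := by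
    intro n
    induction n with
    | zero =>
      refine ⟨fun i => i.elim0, fun i => i.elim0, ?_, ?_, fun i => i.elim0⟩ <;>
      exact ⟨fun i => i.elim0, fun i => i.elim0⟩
    | succ n ih =>
      obtain ⟨e, f, he, hf, h⟩ := ih
      obtain ⟨u, v, hu, hv, heu, hfv, huv⟩ := greedy_step T n (hpos _) e f
      refine ⟨Fin.snoc e u, Fin.snoc f v, orthonormal_snoc he hu heu, orthonormal_snoc hf hv hfv, ?_⟩
      intro i
      induction i using Fin.lastCases with
      | last => simpa using huv
      | cast i => simpa using h i
  have heven : Summable fun k => sVal T (2 * k) := by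
    refine summable_of_sum_range_le (c := 2 * M) (fun k => sVal_nonneg T _) fun n => ?_
    obtain ⟨e, f, he, hf, h⟩ := key n
    have h1 := hM n e f he hf
    have h2 := Finset.sum_le_sum (s := Finset.univ) fun i _ => h i
    rw [← Finset.sum_div, Fin.sum_univ_eq_sum_range (fun i => sVal T (2 * i))] at h2
    linarith
  refine heven.even_add_odd (Summable.of_nonneg_of_le (fun k => sVal_nonneg T _)
    (fun k => sVal_antitone T (by omega)) heven)


/-! ### Power series on the disc -/

lemma ps_summable_deriv {b : ℕ → ℂ} (hb : ∀ z : ℂ, ‖z‖ < 1 → Summable fun j : ℕ => b j * z ^ j)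
    {r : ℝ} (hr0 : 0 ≤ r) (hr1 : r < 1) :
    Summable fun j : ℕ => ‖b (j + 1)‖ * ((j + 1 : ℝ) * r ^ j) := by
  set s : ℝ := (1 + r) / 2 with hs
  have hs0 : 0 < s := by rw [hs]; linarith
  have hs1 : s < 1 := by rw [hs]; linarith
  have hrs : r < s := by rw [hs]; linarith
  have h1 := (hb (s : ℂ) (by rw [Complex.norm_real, Real.norm_of_nonneg hs0.le]; exact hs1)).tendsto_atTop_zero
  obtain ⟨C, hC⟩ := (h1.norm).bddAbove_range
  have hC' : ∀ j, ‖b j‖ * s ^ j ≤ C := by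
    intro j
    have := hC ⟨j, rfl⟩
    simpa [abs_of_pos hs0] using this
  have hq : ‖r / s‖ < 1 := by
    rw [Real.norm_of_nonneg (by positivity), div_lt_one hs0]; exact hrs
  have h2 : Summable fun j : ℕ => (C / s) * ((j : ℝ) ^ 1 * (r / s) ^ j + (r / s) ^ j) :=
    ((summable_pow_mul_geometric_of_norm_lt_one 1 hq).add
      (summable_geometric_of_norm_lt_one hq)).mul_left _
  refine Summable.of_nonneg_of_le (fun j => by positivity) (fun j => ?_) h2
  have h3 : ‖b (j + 1)‖ ≤ C / s ^ (j + 1) := by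
    rw [le_div_iff₀ (by positivity)]; exact hC' _
  calc ‖b (j + 1)‖ * ((j + 1 : ℝ) * r ^ j) ≤ C / s ^ (j + 1) * ((j + 1 : ℝ) * r ^ j) := by gcongr
    _ = _ := by clear_value s; rw [div_pow]; field_simp; ring

lemma ps_summable_norm {b : ℕ → ℂ} (hb : ∀ z : ℂ, ‖z‖ < 1 → Summable fun j : ℕ => b j * z ^ j)
    {r : ℝ} (hr0 : 0 ≤ r) (hr1 : r < 1) :
    Summable fun j : ℕ => ‖b j‖ * r ^ j := by
  rw [← summable_nat_add_iff 1]
  refine Summable.of_nonneg_of_le (fun j => by positivity) (fun j => ?_) (ps_summable_deriv hb hr0 hr1)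
  have h1 : r ^ (j + 1) ≤ r ^ j := pow_le_pow_of_le_one hr0 hr1.le (by omega)
  have h2 : r ^ j ≤ (j + 1 : ℝ) * r ^ j := by
    have : 0 ≤ (j : ℝ) * r ^ j := by positivity
    linarith
  gcongr
  exact h1.trans h2

lemma ps_deriv_summable {b : ℕ → ℂ} (hb : ∀ z : ℂ, ‖z‖ < 1 → Summable fun j : ℕ => b j * z ^ j) :
    ∀ z : ℂ, ‖z‖ < 1 → Summable fun j : ℕ => ((j + 1 : ℂ) * b (j + 1)) * z ^ j := by
  intro z hz
  refine Summable.of_norm ?_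
  convert ps_summable_deriv hb (norm_nonneg z) hz using 2 with j
  have : ‖(j + 1 : ℂ)‖ = j + 1 := by
    have := Complex.norm_natCast (j + 1)
    push_cast at this; exact this
  rw [norm_mul, norm_mul, norm_pow, this]; ring

lemma ps_hasDerivAt {b : ℕ → ℂ} (hb : ∀ z : ℂ, ‖z‖ < 1 → Summable fun j : ℕ => b j * z ^ j)
    {z : ℂ} (hz : ‖z‖ < 1) :
    HasDerivAt (fun z : ℂ => ∑' j : ℕ, b j * z ^ j)
      (∑' j : ℕ, ((j + 1 : ℂ) * b (j + 1)) * z ^ j) z := by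
  obtain ⟨r, hzr, hr1⟩ := exists_between hz
  have hr0 : 0 ≤ r := (norm_nonneg z).trans hzr.le
  have hu : Summable fun j : ℕ => ‖b j‖ * ((j : ℝ) * r ^ (j - 1)) := by
    rw [← summable_nat_add_iff 1]
    simpa using ps_summable_deriv hb hr0 hr1
  have hbound : ∀ (n : ℕ), ∀ y ∈ Metric.ball (0 : ℂ) r,
      ‖b n * ((n : ℂ) * y ^ (n - 1))‖ ≤ ‖b n‖ * ((n : ℝ) * r ^ (n - 1)) := by
    intro n y hy
    rw [mem_ball_zero_iff] at hy
    rw [norm_mul, norm_mul, norm_pow, Complex.norm_natCast]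
    gcongr
  have hd := hasDerivAt_tsum_of_isPreconnected (u := fun j : ℕ => ‖b j‖ * ((j : ℝ) * r ^ (j - 1)))
    (g := fun (j : ℕ) (z : ℂ) => b j * z ^ j)
    (g' := fun (j : ℕ) (z : ℂ) => b j * ((j : ℂ) * z ^ (j - 1))) (t := Metric.ball 0 r) (y₀ := z) (y := z)
    hu Metric.isOpen_ball (convex_ball _ _).isPreconnected
    (fun n y _ => (hasDerivAt_pow n y).const_mul (b n)) hbound (by simpa using hzr) (hb z hz)
    (by simpa using hzr)
  have hsum : Summable fun j : ℕ => b j * ((j : ℂ) * z ^ (j - 1)) :=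
    Summable.of_norm_bounded hu (fun n => hbound n z (by simpa using hzr))
  rw [hsum.tsum_eq_zero_add] at hd
  simp only [Nat.cast_zero, zero_mul, mul_zero, zero_add, Nat.cast_add, Nat.cast_one,
    Nat.add_sub_cancel] at hd
  refine hd.congr_deriv (tsum_congr fun j => ?_)
  ring

lemma ps_dd_summable {a : ℕ → ℂ} (ha : ∀ z : ℂ, ‖z‖ < 1 → Summable fun j : ℕ => a j * z ^ j) :
    ∀ z : ℂ, ‖z‖ < 1 → Summable fun j : ℕ => ((j + 1 : ℂ) * (j + 2) * a (j + 2)) * z ^ j := by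
  intro z hz
  convert ps_deriv_summable (ps_deriv_summable ha) z hz using 2 with j
  push_cast; ring

lemma ps_iteratedDeriv {a : ℕ → ℂ} (ha : ∀ z : ℂ, ‖z‖ < 1 → Summable fun j : ℕ => a j * z ^ j)
    {z : ℂ} (hz : ‖z‖ < 1) :
    iteratedDeriv 2 (fun ζ : ℂ => ∑' j : ℕ, a j * ζ ^ j) z
      = ∑' j : ℕ, ((j + 1 : ℂ) * (j + 2) * a (j + 2)) * z ^ j := by
  rw [iteratedDeriv_succ, iteratedDeriv_one]
  have h1 : deriv (fun ζ : ℂ => ∑' j : ℕ, a j * ζ ^ j) =ᶠ[nhds z]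
      fun ζ => ∑' j : ℕ, ((j + 1 : ℂ) * a (j + 1)) * ζ ^ j := by
    filter_upwards [Metric.isOpen_ball.mem_nhds (show z ∈ Metric.ball (0 : ℂ) 1 by simpa using hz)] with w hw
    exact (ps_hasDerivAt ha (by simpa using hw)).deriv
  rw [h1.deriv_eq, (ps_hasDerivAt (ps_deriv_summable ha) hz).deriv]
  refine tsum_congr fun j => ?_
  push_cast; ring

lemma ps_continuousOn {b : ℕ → ℂ} (hb : ∀ z : ℂ, ‖z‖ < 1 → Summable fun j : ℕ => b j * z ^ j) :
    ContinuousOn (fun z : ℂ => ∑' j : ℕ, b j * z ^ j) (Metric.ball 0 1) := fun z hz =>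
  (ps_hasDerivAt hb (by simpa using hz)).continuousAt.continuousWithinAt

/-! ### Moments -/

local notation "conj" => starRingEnd ℂ

lemma radial_orth (φ : ℝ → ℂ) {j k : ℕ} (hjk : j ≠ k) :
    ∫ z : ℂ, φ ‖z‖ * (z ^ j * conj z ^ k) = 0 := by
  set t : ℝ := π / ((j : ℝ) - k) with ht
  have hne : ((j : ℝ) - k) ≠ 0 := sub_ne_zero.2 (by exact_mod_cast hjk)
  set u : Circle := Circle.exp t with hu
  have hmp := (rotation u).measurePreserving
  have h1 := hmp.integral_comp (rotation u).toHomeomorph.measurableEmbedding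
    (fun z : ℂ => φ ‖z‖ * (z ^ j * conj z ^ k))
  have h2 : ∀ z : ℂ, φ ‖rotation u z‖ * ((rotation u z) ^ j * conj (rotation u z) ^ k)
      = (-1) * (φ ‖z‖ * (z ^ j * conj z ^ k)) := by
    intro z
    rw [LinearIsometryEquiv.norm_map, rotation_apply]
    have hcu : (u : ℂ) ^ j * conj (u : ℂ) ^ k = -1 := by
      rw [hu, Circle.coe_exp, ← Complex.exp_conj, ← Complex.exp_nat_mul, ← Complex.exp_nat_mul,
        ← Complex.exp_add]
      have : (j : ℂ) * (t * I) + k * conj (t * I) = π * I := by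
        simp only [map_mul, Complex.conj_ofReal, Complex.conj_I]
        have h3 : ((j : ℂ) - k) * (t : ℂ) = π := by
          rw [ht]; push_cast
          rw [mul_div_cancel₀]
          exact_mod_cast hne
        linear_combination I * h3
      rw [this, Complex.exp_pi_mul_I]
    rw [map_mul, mul_pow, mul_pow]
    linear_combination (φ ‖z‖ * (z ^ j * conj z ^ k)) * hcu
  simp_rw [h2] at h1
  rw [integral_const_mul] at h1
  have : (2 : ℂ) * ∫ z : ℂ, φ ‖z‖ * (z ^ j * conj z ^ k) = 0 := by linear_combination -h1
  simpa using this

lemma radial_diag (φ : ℝ → ℂ) (k : ℕ) :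
    ∫ z : ℂ, φ ‖z‖ * (z ^ k * conj z ^ k) = 2 * π * ∫ y in Set.Ioi (0 : ℝ), (y : ℂ) ^ (2 * k + 1) * φ y := by
  have h := integral_fun_norm_addHaar (volume : Measure ℂ) (fun y => φ y * (y : ℂ) ^ (2 * k))
  have h1 : ∀ z : ℂ, φ ‖z‖ * (z ^ k * conj z ^ k) = φ ‖z‖ * (‖z‖ : ℂ) ^ (2 * k) := by
    intro z
    rw [← mul_pow, Complex.mul_conj, Complex.normSq_eq_norm_sq, pow_mul]; push_cast; rfl
  simp_rw [h1, h]
  rw [Complex.finrank_real_complex]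
  have h2 : (volume : Measure ℂ).real (Metric.ball 0 1) = π := by
    simp [Measure.real, Complex.volume_ball]
  rw [h2]
  simp only [nsmul_eq_mul, Complex.real_smul]
  push_cast
  rw [mul_assoc]
  congr 2
  refine integral_congr_ae (Filter.Eventually.of_forall fun y => ?_)
  simp only [pow_one]
  ring

lemma ball_moment (φ : ℝ → ℂ) {ρ : ℝ} (hρ : 0 ≤ ρ) (j k : ℕ) :
    ∫ z in Metric.ball (0 : ℂ) ρ, φ ‖z‖ * (z ^ j * conj z ^ k)
      = if j = k then 2 * π * ∫ y in (0 : ℝ)..ρ, (y : ℂ) ^ (2 * k + 1) * φ y else 0 := by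
  have h1 : ∫ z in Metric.ball (0 : ℂ) ρ, φ ‖z‖ * (z ^ j * conj z ^ k)
      = ∫ z : ℂ, ((Set.Iio ρ).indicator φ) ‖z‖ * (z ^ j * conj z ^ k) := by
    rw [← integral_indicator Metric.isOpen_ball.measurableSet]
    congr 1
    ext z
    by_cases hz : ‖z‖ < ρ
    · rw [Set.indicator_of_mem (by simpa using hz), Set.indicator_of_mem (by simpa using hz)]
    · rw [Set.indicator_of_notMem (by simpa using hz), Set.indicator_of_notMem (by simpa using hz), zero_mul]
  rw [h1]
  split_ifs with hjk
  · subst hjk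
    rw [radial_diag]
    congr 1
    rw [intervalIntegral.integral_of_le hρ, integral_Ioc_eq_integral_Ioo]
    rw [← integral_indicator measurableSet_Ioi, ← integral_indicator measurableSet_Ioo]
    congr 1
    ext y
    simp only [Set.indicator_apply, Set.mem_Ioi, Set.mem_Iio, Set.mem_Ioo]
    split_ifs <;> simp_all
  · exact radial_orth _ hjk

lemma ball_moment_one (j k : ℕ) :
    ∫ z in Metric.ball (0 : ℂ) 1, (z ^ j * conj z ^ k)
      = if j = k then (π : ℂ) / (k + 1) else 0 := by
  have h := ball_moment (fun _ => 1) zero_le_one j k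
  simp only [one_mul, mul_one] at h
  rw [h]
  congr 1
  have : ∫ y in (0 : ℝ)..1, (y : ℂ) ^ (2 * k + 1) = 1 / (2 * k + 2) := by
    have h2 : ∀ y : ℝ, (y : ℂ) ^ (2 * k + 1) = ((y ^ (2 * k + 1) : ℝ) : ℂ) := by intro y; push_cast; rfl
    simp_rw [h2]
    rw [intervalIntegral.integral_ofReal, integral_pow]
    push_cast
    simp
    ring
  rw [this]
  have : (k + 1 : ℂ) ≠ 0 := by exact_mod_cast k.succ_ne_zero
  have h2 : (2 * k + 2 : ℂ) ≠ 0 := by exact_mod_cast (by omega : 2 * k + 2 ≠ 0)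
  field_simp

lemma ball_moment_weight {ρ : ℝ} (hρ : 0 ≤ ρ) (j k : ℕ) :
    ∫ z in Metric.ball (0 : ℂ) ρ, (1 - (‖z‖ : ℂ) ^ 2) * (z ^ j * conj z ^ k)
      = if j = k then (π : ℂ) * (ρ ^ (2 * k + 2) / (k + 1) - ρ ^ (2 * k + 4) / (k + 2)) else 0 := by
  have h := ball_moment (fun y => 1 - (y : ℂ) ^ 2) hρ j k
  rw [h]
  congr 1
  have : ∫ y in (0 : ℝ)..ρ, (y : ℂ) ^ (2 * k + 1) * (1 - (y : ℂ) ^ 2)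
      = (ρ : ℂ) ^ (2 * k + 2) / (2 * k + 2) - (ρ : ℂ) ^ (2 * k + 4) / (2 * k + 4) := by
    have h2 : ∀ y : ℝ, (y : ℂ) ^ (2 * k + 1) * (1 - (y : ℂ) ^ 2)
      = ((y ^ (2 * k + 1) - y ^ (2 * k + 3) : ℝ) : ℂ) := by intro y; push_cast; ring
    simp_rw [h2]
    rw [intervalIntegral.integral_ofReal, intervalIntegral.integral_sub
      (by exact (continuous_pow _).intervalIntegrable _ _)
      (by exact (continuous_pow _).intervalIntegrable _ _), integral_pow, integral_pow]
    push_cast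
    simp
    ring
  rw [this]
  have : (k + 1 : ℂ) ≠ 0 := by exact_mod_cast k.succ_ne_zero
  have : (k + 2 : ℂ) ≠ 0 := by exact_mod_cast (by omega : k + 2 ≠ 0)
  have h2 : (2 * k + 2 : ℂ) ≠ 0 := by exact_mod_cast (by omega : 2 * k + 2 ≠ 0)
  have h2 : (2 * k + 4 : ℂ) ≠ 0 := by exact_mod_cast (by omega : 2 * k + 4 ≠ 0)
  have e1 : (2 * k + 2 : ℂ) = 2 * (k + 1) := by ring
  have e2 : (2 * k + 4 : ℂ) = 2 * (k + 2) := by ring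
  rw [e1, e2]
  field_simp


/-! ### Bergman norm -/

lemma parseval_poly (c : ℕ → ℂ) (N : ℕ) :
    ∫⁻ z in Metric.ball (0 : ℂ) 1, ‖∑ k ∈ Finset.range N, c k * z ^ k‖ₑ ^ 2
      = ENNReal.ofReal (π * ∑ k ∈ Finset.range N, ‖c k‖ ^ 2 / (k + 1)) := by
  have hcont : Continuous fun z : ℂ => ∑ k ∈ Finset.range N, c k * z ^ k := by fun_prop
  have hfin : ∀ {E : Type} [NormedAddCommGroup E] {g : ℂ → E}, Continuous g →
      IntegrableOn g (Metric.ball (0 : ℂ) 1) := fun hg =>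
    (hg.continuousOn.integrableOn_compact (isCompact_closedBall (0 : ℂ) 1)).mono_set
      Metric.ball_subset_closedBall
  have h1 : ∀ z : ℂ, ‖∑ k ∈ Finset.range N, c k * z ^ k‖ₑ ^ 2
      = ENNReal.ofReal (‖∑ k ∈ Finset.range N, c k * z ^ k‖ ^ 2) := by
    intro z
    rw [ENNReal.ofReal_pow (norm_nonneg _), ofReal_norm]
  simp_rw [h1]
  rw [← ofReal_integral_eq_lintegral_ofReal (hfin (by fun_prop))
    (Filter.Eventually.of_forall fun z => by positivity)]
  congr 1
  rw [← Complex.ofReal_inj, ← integral_complex_ofReal]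
  have h2 : ∀ z : ℂ, ((‖∑ k ∈ Finset.range N, c k * z ^ k‖ ^ 2 : ℝ) : ℂ)
      = ∑ j ∈ Finset.range N, ∑ k ∈ Finset.range N, (c j * conj (c k)) * (z ^ j * conj z ^ k) := by
    intro z
    rw [← Complex.normSq_eq_norm_sq, ← Complex.mul_conj, map_sum, Finset.sum_mul_sum]
    refine Finset.sum_congr rfl fun j _ => Finset.sum_congr rfl fun k _ => ?_
    simp only [map_mul, map_pow]; ring
  simp_rw [h2]
  rw [integral_finsetSum _ (fun j _ => hfin (by fun_prop))]
  have h3 : ∀ j ∈ Finset.range N, ∫ z in Metric.ball (0 : ℂ) 1,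
      ∑ k ∈ Finset.range N, (c j * conj (c k)) * (z ^ j * conj z ^ k)
        = (π : ℂ) * (‖c j‖ ^ 2 / (j + 1)) := by
    intro j hj
    rw [integral_finsetSum _ (fun k _ => hfin (by fun_prop))]
    simp_rw [integral_const_mul, ball_moment_one, mul_ite, mul_zero]
    rw [Finset.sum_ite_eq, if_pos hj, Complex.mul_conj, Complex.normSq_eq_norm_sq]
    push_cast; ring
  rw [Finset.sum_congr rfl h3]
  push_cast
  rw [Finset.mul_sum]

lemma fatou_ball {F : ℕ → ℂ → ENNReal} {f : ℂ → ENNReal} {M : ENNReal}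
    (hF : ∀ n, AEMeasurable (F n) (volume.restrict (Metric.ball (0 : ℂ) 1)))
    (h : ∀ z ∈ Metric.ball (0 : ℂ) 1, Filter.Tendsto (fun n => F n z) Filter.atTop (nhds (f z)))
    (hM : ∀ n, ∫⁻ z in Metric.ball (0 : ℂ) 1, F n z ≤ M) :
    ∫⁻ z in Metric.ball (0 : ℂ) 1, f z ≤ M := by
  calc ∫⁻ z in Metric.ball (0 : ℂ) 1, f z
      = ∫⁻ z in Metric.ball (0 : ℂ) 1, Filter.liminf (fun n => F n z) Filter.atTop :=
        setLIntegral_congr_fun Metric.isOpen_ball.measurableSet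
          fun z hz => (h z hz).liminf_eq.symm
    _ ≤ Filter.liminf (fun n => ∫⁻ z in Metric.ball (0 : ℂ) 1, F n z) Filter.atTop :=
        lintegral_liminf_le' hF
    _ ≤ M := by
        refine (Filter.liminf_le_liminf (Filter.Eventually.of_forall hM)).trans ?_
        simp

lemma parseval_le (c : ℕ → ℂ) (C : ℝ)
    (hC : ∀ N, ∑ k ∈ Finset.range N, ‖c k‖ ^ 2 / (k + 1) ≤ C)
    (hc : ∀ z : ℂ, ‖z‖ < 1 → Summable fun j : ℕ => c j * z ^ j) :
    ∫⁻ z in Metric.ball (0 : ℂ) 1, ‖∑' k, c k * z ^ k‖ₑ ^ 2 ≤ ENNReal.ofReal (π * C) := by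
  refine fatou_ball (F := fun N z => ‖∑ k ∈ Finset.range N, c k * z ^ k‖ₑ ^ 2) ?_ ?_ ?_
  · intro n
    have : Continuous fun z : ℂ => ‖∑ k ∈ Finset.range n, c k * z ^ k‖ₑ ^ 2 := by fun_prop
    exact this.measurable.aemeasurable
  · intro z hz
    have h1 := (hc z (by simpa using hz)).hasSum.tendsto_sum_nat
    exact ((ENNReal.continuous_pow 2).tendsto _).comp ((continuous_enorm.tendsto _).comp h1)
  · intro n
    rw [parseval_poly]
    refine ENNReal.ofReal_le_ofReal ?_
    exact mul_le_mul_of_nonneg_left (hC n) pi_pos.le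

/-! ### The vectors `hvec` -/

/-- `hvec w z = ∑ w_k z^k e_{k+1}`. -/
def hvec (w : ℕ → ℝ) (z : ℂ) : l2 := ∑' k : ℕ, ((w k : ℂ) * z ^ k) • lp.single 2 (k + 1) (1 : ℂ)

lemma hvec_term_le {w : ℕ → ℝ} (hw : ∀ k, |w k| ≤ k + 1) {z : ℂ} {r : ℝ} (hz : ‖z‖ ≤ r) (k : ℕ) :
    ‖((w k : ℂ) * z ^ k) • (lp.single 2 (k + 1) (1 : ℂ) : l2)‖ ≤ ‖(1 : ℂ)‖ * ((k + 1 : ℝ) * r ^ k) := by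
  rw [norm_smul, lp.norm_single (by norm_num), norm_mul, norm_pow, Complex.norm_real, norm_one, mul_one, one_mul]
  have := hw k
  rw [Real.norm_eq_abs]
  gcongr

lemma one_ps : ∀ z : ℂ, ‖z‖ < 1 → Summable fun j : ℕ => (fun _ => (1 : ℂ)) j * z ^ j := by
  intro z hz
  simpa using summable_geometric_of_norm_lt_one hz

lemma hvec_hasSum {w : ℕ → ℝ} (hw : ∀ k, |w k| ≤ k + 1) {z : ℂ} (hz : ‖z‖ < 1) :
    HasSum (fun k : ℕ => ((w k : ℂ) * z ^ k) • (lp.single 2 (k + 1) (1 : ℂ) : l2)) (hvec w z) :=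
  (Summable.of_norm_bounded (ps_summable_deriv one_ps (norm_nonneg z) hz)
    (fun k => hvec_term_le hw le_rfl k)).hasSum

lemma hvec_continuousOn {w : ℕ → ℝ} (hw : ∀ k, |w k| ≤ k + 1) :
    ContinuousOn (hvec w) (Metric.ball 0 1) := by
  intro z hz
  obtain ⟨r, hzr, hr1⟩ := exists_between (show ‖z‖ < 1 by simpa using hz)
  have hr0 : 0 ≤ r := (norm_nonneg z).trans hzr.le
  have : ContinuousOn (hvec w) (Metric.ball 0 r) := by
    refine continuousOn_tsum (fun k => ?_) (ps_summable_deriv one_ps hr0 hr1)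
      (fun k x hx => hvec_term_le hw (by simpa using (show ‖x‖ < r by simpa using hx).le) k)
    fun_prop
  exact (this.continuousAt (Metric.isOpen_ball.mem_nhds (by simpa using hzr))).continuousWithinAt

lemma hasSum_inner_hvec {w : ℕ → ℝ} (hw : ∀ k, |w k| ≤ k + 1) {z : ℂ} (hz : ‖z‖ < 1) (x : l2) :
    HasSum (fun k : ℕ => ((w k : ℂ) * conj (x (k + 1))) * z ^ k) (inner ℂ x (hvec w z)) := by
  have h := (innerSL ℂ x).hasSum (hvec_hasSum hw hz)
  simp only [innerSL_apply_apply, inner_smul_right, lp.inner_single_right] at h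
  have e : (fun k : ℕ => ((w k : ℂ) * conj (x (k + 1))) * z ^ k)
      = fun k : ℕ => (w k : ℂ) * z ^ k * inner ℂ (x (k + 1)) 1 := by
    funext k
    simp
    ring
  rw [e]
  exact h

lemma hasSum_hvec_inner {w : ℕ → ℝ} (hw : ∀ k, |w k| ≤ k + 1) {z : ℂ} (hz : ‖z‖ < 1) (x : l2) :
    HasSum (fun k : ℕ => ((w k : ℂ) * x (k + 1)) * z ^ k) (inner ℂ (hvec w (conj z)) x) := by
  have h := hasSum_inner_hvec hw (z := conj z) (by simpa using hz) x
  have h2 := Complex.hasSum_conj'.2 h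
  rw [inner_conj_symm] at h2
  have e : (fun k : ℕ => ((w k : ℂ) * x (k + 1)) * z ^ k)
      = fun k : ℕ => conj ((w k : ℂ) * conj (x (k + 1)) * conj z ^ k) := by
    funext k
    simp
  rw [e]
  exact h2

lemma hvec_coord {w : ℕ → ℝ} (hw : ∀ k, |w k| ≤ k + 1) {z : ℂ} (hz : ‖z‖ < 1) (j : ℕ) :
    hvec w z (j + 1) = w j * z ^ j := by
  have h := hasSum_inner_hvec hw hz (lp.single 2 (j + 1) (1 : ℂ))
  rw [lp.inner_single_left] at h
  have h2 := hasSum_single (f := fun k : ℕ =>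
    ((w k : ℂ) * conj ((lp.single 2 (j + 1) (1 : ℂ) : l2) (k + 1))) * z ^ k) j (by
      intro k hk
      have : (lp.single 2 (j + 1) (1 : ℂ) : l2) (k + 1) = 0 := by
        simp [lp.coeFn_single, hk]
      rw [this]; simp)
  have h3 := h.unique h2
  simpa using h3

lemma hvec_coord_zero {w : ℕ → ℝ} (hw : ∀ k, |w k| ≤ k + 1) {z : ℂ} (hz : ‖z‖ < 1) :
    hvec w z 0 = 0 := by
  have h := hasSum_inner_hvec hw hz (lp.single 2 0 (1 : ℂ))
  rw [lp.inner_single_left] at h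
  have e : (fun k : ℕ => ((w k : ℂ) * conj ((lp.single 2 0 (1 : ℂ) : l2) (k + 1))) * z ^ k)
      = fun _ => 0 := by
    funext k
    have : (lp.single 2 0 (1 : ℂ) : l2) (k + 1) = 0 := by simp
    rw [this]; simp
  rw [e] at h
  simpa using h.unique hasSum_zero

lemma hvec_one_norm_sq {z : ℂ} (hz : ‖z‖ < 1) : ‖hvec (fun _ => 1) z‖ ^ 2 = (1 - ‖z‖ ^ 2)⁻¹ := by
  have hw : ∀ k : ℕ, |(fun _ => (1 : ℝ)) k| ≤ k + 1 := by intro k; simp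
  have h := hasSum_inner_hvec hw hz (hvec (fun _ => 1) z)
  have h1 : ∀ k : ℕ, (((fun _ => (1 : ℝ)) k : ℂ) * conj (hvec (fun _ => 1) z (k + 1))) * z ^ k
      = (((‖z‖ ^ 2) ^ k : ℝ) : ℂ) := by
    intro k
    rw [hvec_coord hw hz]
    simp only [Complex.ofReal_one, one_mul, map_pow]
    rw [← mul_pow, mul_comm, Complex.mul_conj, Complex.normSq_eq_norm_sq]
    push_cast; rfl
  simp_rw [h1] at h
  have h0 : inner ℂ (hvec (fun _ => 1) z) (hvec (fun _ => 1) z)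
    = ((‖hvec (fun _ => 1) z‖ ^ 2 : ℝ) : ℂ) := by
      rw [inner_self_eq_norm_sq_to_K]; push_cast; rfl
  rw [h0, Complex.hasSum_ofReal] at h
  exact h.unique (hasSum_geometric_of_lt_one (by positivity) (by
    have := norm_nonneg z
    nlinarith))

/-! ### The weights -/

/-- Taylor coefficients of `(1 - x) ^ (-3/2)`. -/
def wt : ℕ → ℝ
  | 0 => 1
  | k + 1 => wt k * ((2 * k + 3) / (2 * k + 2))

lemma wt_pos (k : ℕ) : 0 < wt k := by
  induction k with
  | zero => simp [wt]
  | succ k ih => rw [wt]; positivity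

lemma wt_sq (k : ℕ) : wt k ^ 2 ≤ 2 * k + 1 := by
  induction k with
  | zero => simp [wt]
  | succ k ih =>
    rw [wt, mul_pow, div_pow]
    push_cast
    calc wt k ^ 2 * ((2 * k + 3 : ℝ) ^ 2 / (2 * k + 2) ^ 2)
        ≤ (2 * k + 1) * ((2 * k + 3 : ℝ) ^ 2 / (2 * k + 2) ^ 2) := by gcongr
      _ ≤ 2 * ((k : ℝ) + 1) + 1 := by
        rw [← mul_div_assoc, div_le_iff₀ (by positivity)]
        nlinarith [(k.cast_nonneg : (0 : ℝ) ≤ k)]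

lemma wt_le (k : ℕ) : |wt k| ≤ k + 1 := by
  refine abs_le_of_sq_le_sq ?_ (by positivity)
  nlinarith [wt_sq k, sq_nonneg (k : ℝ)]

lemma wt_conv (n : ℕ) : ∑ p ∈ Finset.HasAntidiagonal.antidiagonal n, wt p.1 * wt p.2 = (n + 1) * (n + 2) / 2 := by
  set W : PowerSeries ℝ := PowerSeries.mk wt with hW
  have hD : (1 - PowerSeries.X) * PowerSeries.derivative ℝ W = PowerSeries.C (3 / 2 : ℝ) * W := by
    ext n
    rw [sub_mul, one_mul, map_sub, PowerSeries.coeff_C_mul, PowerSeries.coeff_derivative]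
    cases n with
    | zero => simp [hW, wt]
    | succ n =>
      rw [PowerSeries.coeff_succ_X_mul, PowerSeries.coeff_derivative]
      simp only [hW, PowerSeries.coeff_mk, wt]
      push_cast
      field_simp
      ring
  have hV : (1 - PowerSeries.X) * PowerSeries.derivative ℝ (W * W) = PowerSeries.C (3 : ℝ) * (W * W) := by
    rw [Derivation.leibniz, smul_eq_mul]
    have h3 : PowerSeries.C (3 : ℝ) = PowerSeries.C (3 / 2 : ℝ) + PowerSeries.C (3 / 2 : ℝ) := by
      rw [← map_add]; norm_num
    rw [h3]
    linear_combination (2 * W) * hD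
  have hrec : ∀ n : ℕ, ((n : ℝ) + 1) * PowerSeries.coeff (n + 1) (W * W)
      = (n + 3) * PowerSeries.coeff n (W * W) := by
    intro n
    have h := congrArg (PowerSeries.coeff n) hV
    rw [sub_mul, one_mul, map_sub, PowerSeries.coeff_C_mul, PowerSeries.coeff_derivative] at h
    cases n with
    | zero => simp at h ⊢; linarith
    | succ n =>
      rw [PowerSeries.coeff_succ_X_mul, PowerSeries.coeff_derivative] at h
      push_cast at h ⊢
      linarith
  have hmain : ∀ n : ℕ, PowerSeries.coeff n (W * W) = ((n : ℝ) + 1) * (n + 2) / 2 := by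
    intro n
    induction n with
    | zero => simp [hW, wt]
    | succ n ih =>
      have h := hrec n
      rw [ih] at h
      have hn : (n : ℝ) + 1 ≠ 0 := by positivity
      push_cast
      apply mul_left_cancel₀ hn
      rw [h]; ring
  rw [← hmain n, PowerSeries.coeff_mul]
  simp [hW]

lemma wt_coeff_sum_le (x : l2) (N : ℕ) (c : ℕ → ℂ) (hc : ∀ k, ‖c k‖ = wt k * ‖x (k + 1)‖) :
    ∑ k ∈ Finset.range N, ‖c k‖ ^ 2 / (k + 1) ≤ 2 * ‖x‖ ^ 2 := by
  have h1 : ∑ k ∈ Finset.range N, ‖x (k + 1)‖ ^ 2 ≤ ‖x‖ ^ 2 := by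
    have h := lp.sum_rpow_le_norm_rpow (p := 2) (by norm_num) x
      ((Finset.range N).map ⟨Nat.succ, Nat.succ_injective⟩)
    rw [Finset.sum_map] at h
    simpa using h
  refine le_trans ?_ (mul_le_mul_of_nonneg_left h1 (by norm_num : (0 : ℝ) ≤ 2))
  rw [Finset.mul_sum]
  refine Finset.sum_le_sum fun k _ => ?_
  rw [hc, mul_pow, div_le_iff₀ (by positivity)]
  have := wt_sq k
  have h2 : wt k ^ 2 ≤ 2 * (k + 1) := by linarith
  calc wt k ^ 2 * ‖x (k + 1)‖ ^ 2 ≤ 2 * (k + 1) * ‖x (k + 1)‖ ^ 2 := by gcongr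
    _ = _ := by ring

lemma inner_hvec_L2 (x : l2) :
    ∫⁻ z in Metric.ball (0 : ℂ) 1, ‖inner ℂ x (hvec wt z)‖ₑ ^ 2
      ≤ ENNReal.ofReal (π * (2 * ‖x‖ ^ 2)) := by
  have h := parseval_le (fun k => (wt k : ℂ) * conj (x (k + 1))) (2 * ‖x‖ ^ 2)
    (fun N => wt_coeff_sum_le x N _ fun k => by
      rw [norm_mul, RCLike.norm_conj, Complex.norm_real, Real.norm_of_nonneg (wt_pos k).le])
    (fun z hz => (hasSum_inner_hvec wt_le hz x).summable)
  refine le_trans (le_of_eq ?_) h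
  refine setLIntegral_congr_fun Metric.isOpen_ball.measurableSet fun z hz => ?_
  simp only
  rw [(hasSum_inner_hvec wt_le (by simpa using hz) x).tsum_eq]

lemma hvec_inner_L2 (x : l2) :
    ∫⁻ z in Metric.ball (0 : ℂ) 1, ‖inner ℂ (hvec wt (conj z)) x‖ₑ ^ 2
      ≤ ENNReal.ofReal (π * (2 * ‖x‖ ^ 2)) := by
  have h := parseval_le (fun k => (wt k : ℂ) * x (k + 1)) (2 * ‖x‖ ^ 2)
    (fun N => wt_coeff_sum_le x N _ fun k => by
      rw [norm_mul, Complex.norm_real, Real.norm_of_nonneg (wt_pos k).le])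
    (fun z hz => (hasSum_hvec_inner wt_le hz x).summable)
  refine le_trans (le_of_eq ?_) h
  refine setLIntegral_congr_fun Metric.isOpen_ball.measurableSet fun z hz => ?_
  simp only
  rw [(hasSum_hvec_inner wt_le (by simpa using hz) x).tsum_eq]


/-! ### Trace class implies integrability -/

/-- The averaged symbol of an operator. -/
def GT (T : l2 →L[ℂ] l2) (z : ℂ) : ℂ := inner ℂ (hvec wt (conj z)) (T (hvec wt z))

lemma GT_hankel {a : ℕ → ℂ} {T : l2 →L[ℂ] l2}
    (hT : ∀ j k : ℕ, (T (lp.single 2 k 1)) j = a (j + k)) {z : ℂ} (hz : ‖z‖ < 1) :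
    2 * GT T z = ∑' n : ℕ, ((n + 1 : ℂ) * (n + 2) * a (n + 2)) * z ^ n := by
  set f : ℕ × ℕ → ℂ := fun p => ((wt p.1 : ℂ) * z ^ p.1) * ((wt p.2 * a (p.1 + p.2 + 2)) * z ^ p.2)
    with hf
  have hrow : ∀ k : ℕ, HasSum (fun j => f (k, j))
      (((wt k : ℂ) * z ^ k) * inner ℂ (hvec wt (conj z)) (T (lp.single 2 (k + 1) 1))) := by
    intro k
    have h := (hasSum_hvec_inner wt_le hz (T (lp.single 2 (k + 1) 1))).mul_left ((wt k : ℂ) * z ^ k)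
    simp_rw [hT] at h
    have e : (fun j => f (k, j)) = fun j => ((wt k : ℂ) * z ^ k) *
        ((wt j : ℂ) * a (j + 1 + (k + 1)) * z ^ j) := by
      funext j
      simp only [hf]
      rw [show j + 1 + (k + 1) = k + j + 2 by ring]
    rw [e]; exact h
  have hcol : HasSum (fun k : ℕ => ((wt k : ℂ) * z ^ k) *
      inner ℂ (hvec wt (conj z)) (T (lp.single 2 (k + 1) 1))) (GT T z) := by
    have h := ((innerSL ℂ (hvec wt (conj z))) ∘L T).hasSum (hvec_hasSum wt_le hz)
    simp only [ContinuousLinearMap.comp_apply, map_smul, innerSL_apply_apply, smul_eq_mul] at h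
    exact h
  have hab : ∀ n, ‖a n‖ ≤ ‖T‖ := by
    intro n
    have h1 : ‖(T (lp.single 2 0 1)) n‖ ≤ ‖T (lp.single 2 0 1)‖ := lp.norm_apply_le_norm (by norm_num) _ _
    have h2 := T.le_opNorm (lp.single 2 0 1)
    rw [lp.norm_single (by norm_num), norm_one, mul_one] at h2
    rw [hT] at h1
    exact h1.trans h2
  have hu := ps_summable_deriv one_ps (norm_nonneg z) hz
  have hfs : Summable f := by
    refine Summable.of_norm_bounded ((hu.mul_of_nonneg hu (fun k => by positivity)
      (fun k => by positivity)).mul_left ‖T‖) ?_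
    rintro ⟨k, j⟩
    simp only [hf, norm_mul, norm_pow, Complex.norm_real, norm_one, one_mul]
    have h1 := wt_le k
    have h2 := wt_le j
    rw [← Real.norm_eq_abs] at h1 h2
    calc ‖wt k‖ * ‖z‖ ^ k * (‖wt j‖ * ‖a (k + j + 2)‖ * ‖z‖ ^ j)
        ≤ (k + 1) * ‖z‖ ^ k * ((j + 1) * ‖T‖ * ‖z‖ ^ j) := by
          gcongr
          exact hab _
      _ = _ := by ring
  have hsum1 : ∑' p, f p = GT T z := (hfs.hasSum.prod_fiberwise hrow).unique hcol
  have hsig := (Finset.HasAntidiagonal.sigmaAntidiagonalEquivProd (A := ℕ)).hasSum_iff.2 hfs.hasSum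
  have hn := hsig.sigma (fun n => hasSum_fintype _)
  rw [hsum1] at hn
  have e : ∀ n : ℕ, ∑ b : ↥(Finset.HasAntidiagonal.antidiagonal n),
      (f ∘ (Finset.HasAntidiagonal.sigmaAntidiagonalEquivProd (A := ℕ))) ⟨n, b⟩
      = ((n + 1 : ℂ) * (n + 2) / 2 * a (n + 2)) * z ^ n := by
    intro n
    simp only [Function.comp, Finset.HasAntidiagonal.sigmaAntidiagonalEquivProd_apply]
    rw [Finset.sum_coe_sort (Finset.HasAntidiagonal.antidiagonal n) (fun p => f p)]
    have hc : ((∑ p ∈ Finset.HasAntidiagonal.antidiagonal n, wt p.1 * wt p.2 : ℝ) : ℂ)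
        = (n + 1 : ℂ) * (n + 2) / 2 := by
      rw [wt_conv]; push_cast; ring
    rw [← hc]
    push_cast
    rw [Finset.sum_mul, Finset.sum_mul]
    refine Finset.sum_congr rfl fun p hp => ?_
    rw [Finset.HasAntidiagonal.mem_antidiagonal] at hp
    simp only [hf]
    rw [← hp, pow_add]
    ring
  simp_rw [e] at hn
  rw [← hn.tsum_eq, ← tsum_mul_left]
  refine tsum_congr fun n => ?_
  ring

lemma conj_mem_ball {z : ℂ} (hz : z ∈ Metric.ball (0 : ℂ) 1) : conj z ∈ Metric.ball (0 : ℂ) 1 := by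
  simpa using hz

lemma hvec_conj_continuousOn {w : ℕ → ℝ} (hw : ∀ k, |w k| ≤ k + 1) :
    ContinuousOn (fun z : ℂ => hvec w (conj z)) (Metric.ball 0 1) :=
  (hvec_continuousOn hw).comp Complex.continuous_conj.continuousOn fun _ hz => conj_mem_ball hz

lemma GT_continuousOn (T : l2 →L[ℂ] l2) : ContinuousOn (GT T) (Metric.ball 0 1) :=
  (hvec_conj_continuousOn wt_le).inner (𝕜 := ℂ) (T.continuous.comp_continuousOn (hvec_continuousOn wt_le))

lemma aemeas_enorm {f : ℂ → ℂ} (hf : ContinuousOn f (Metric.ball 0 1)) :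
    AEMeasurable (fun z => ‖f z‖ₑ) (volume.restrict (Metric.ball (0 : ℂ) 1)) :=
  (hf.aestronglyMeasurable Metric.isOpen_ball.measurableSet).enorm

lemma GT_rankOne_bound (u v : l2) :
    ∫⁻ z in Metric.ball (0 : ℂ) 1,
      ‖inner ℂ (hvec wt (conj z)) u‖ₑ * ‖inner ℂ v (hvec wt z)‖ₑ
      ≤ ENNReal.ofReal (2 * π * (‖u‖ * ‖v‖)) := by
  have h := ENNReal.lintegral_mul_le_Lp_mul_Lq (volume.restrict (Metric.ball (0 : ℂ) 1))
    Real.HolderConjugate.two_two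
    (aemeas_enorm ((hvec_conj_continuousOn wt_le).inner (𝕜 := ℂ) (continuousOn_const (c := u))))
    (aemeas_enorm ((continuousOn_const (c := v)).inner (𝕜 := ℂ) (hvec_continuousOn wt_le)))
  refine (le_trans (le_of_eq ?_) h).trans ?_
  · rfl
  · have e : ∀ x : ENNReal, x ^ (2 : ℝ) = x ^ 2 := fun x => by
      rw [← ENNReal.rpow_natCast]; norm_num
    simp_rw [e]
    calc _ ≤ ENNReal.ofReal (π * (2 * ‖u‖ ^ 2)) ^ (1 / 2 : ℝ) *
          ENNReal.ofReal (π * (2 * ‖v‖ ^ 2)) ^ (1 / 2 : ℝ) := by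
          gcongr
          · exact hvec_inner_L2 u
          · exact inner_hvec_L2 v
      _ = _ := by
          rw [← ENNReal.mul_rpow_of_nonneg _ _ (by norm_num), ← ENNReal.ofReal_mul (by positivity),
            ENNReal.ofReal_rpow_of_nonneg (by positivity) (by norm_num)]
          congr 1
          rw [← Real.sqrt_eq_rpow]
          rw [show π * (2 * ‖u‖ ^ 2) * (π * (2 * ‖v‖ ^ 2)) = (2 * π * (‖u‖ * ‖v‖)) ^ 2 by ring]
          exact Real.sqrt_sq (by positivity)

lemma GT_finrank_bound (R : l2 →L[ℂ] l2) (n : ℕ) (hR : (R : l2 →ₗ[ℂ] l2).rank ≤ (n : Cardinal)) :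
    ∫⁻ z in Metric.ball (0 : ℂ) 1, ‖GT R z‖ₑ ≤ ENNReal.ofReal (2 * π * (n * ‖R‖)) := by
  set V := LinearMap.range (R : l2 →ₗ[ℂ] l2) with hV
  have hR' : Module.rank ℂ V ≤ (n : Cardinal) := hR
  have hfd : FiniteDimensional ℂ V :=
    Module.rank_lt_aleph0_iff.1 (hR'.trans_lt Cardinal.natCast_lt_aleph0)
  have hfr : Module.finrank ℂ V ≤ n := Module.finrank_le_of_rank_le hR'
  set b := stdOrthonormalBasis ℂ V with hb
  have hdec : ∀ x, R x = ∑ i, (inner ℂ (b i : l2) (R x)) • (b i : l2) := by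
    intro x
    have h := b.sum_repr' ⟨R x, ⟨x, rfl⟩⟩
    have h2 := congrArg (Subtype.val) h
    simpa using h2.symm
  have hbn : ∀ i, ‖(b i : l2)‖ = 1 := fun i => by
    rw [← Submodule.coe_norm]
    exact b.norm_eq_one i
  have hpt : ∀ z, ‖GT R z‖ₑ ≤ ∑ i, ‖inner ℂ (hvec wt (conj z)) (b i : l2)‖ₑ *
      ‖inner ℂ (ContinuousLinearMap.adjoint R (b i : l2)) (hvec wt z)‖ₑ := by
    intro z
    rw [GT, hdec, inner_sum]
    refine (enorm_sum_le _ _).trans (le_of_eq (Finset.sum_congr rfl fun i _ => ?_))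
    rw [inner_smul_right, enorm_mul, mul_comm, ContinuousLinearMap.adjoint_inner_left]
  calc ∫⁻ z in Metric.ball (0 : ℂ) 1, ‖GT R z‖ₑ
      ≤ ∫⁻ z in Metric.ball (0 : ℂ) 1, ∑ i, ‖inner ℂ (hvec wt (conj z)) (b i : l2)‖ₑ *
        ‖inner ℂ (ContinuousLinearMap.adjoint R (b i : l2)) (hvec wt z)‖ₑ := lintegral_mono hpt
    _ = ∑ i, ∫⁻ z in Metric.ball (0 : ℂ) 1, ‖inner ℂ (hvec wt (conj z)) (b i : l2)‖ₑ *
        ‖inner ℂ (ContinuousLinearMap.adjoint R (b i : l2)) (hvec wt z)‖ₑ := by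
        refine lintegral_finsetSum' _ fun i _ => ?_
        exact (aemeas_enorm ((hvec_conj_continuousOn wt_le).inner (𝕜 := ℂ) continuousOn_const)).mul
          (aemeas_enorm (continuousOn_const.inner (𝕜 := ℂ) (hvec_continuousOn wt_le)))
    _ ≤ ∑ i : Fin (Module.finrank ℂ V), ENNReal.ofReal (2 * π * ‖R‖) := by
        refine Finset.sum_le_sum fun i _ => (GT_rankOne_bound _ _).trans ?_
        refine ENNReal.ofReal_le_ofReal ?_
        have h1 := (ContinuousLinearMap.adjoint R).le_opNorm (b i : l2)
        rw [LinearIsometryEquiv.norm_map, hbn, mul_one] at h1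
        rw [hbn, one_mul]
        gcongr
    _ ≤ _ := by
        rw [Finset.sum_const, Finset.card_univ, Fintype.card_fin, nsmul_eq_mul,
          ← ENNReal.ofReal_natCast, ← ENNReal.ofReal_mul (by positivity)]
        refine ENNReal.ofReal_le_ofReal ?_
        have : (Module.finrank ℂ V : ℝ) ≤ n := by exact_mod_cast hfr
        calc (Module.finrank ℂ V : ℝ) * (2 * π * ‖R‖) ≤ n * (2 * π * ‖R‖) := by gcongr
          _ = _ := by ring

lemma GT_traceClass_bound {T : l2 →L[ℂ] l2} (hT : MemTraceClass T) :
    ∃ M : ℝ, ∫⁻ z in Metric.ball (0 : ℂ) 1, ‖GT T z‖ₑ ≤ ENNReal.ofReal M := by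
  set t : ℕ → ℝ := fun n => sVal T n + (1 / 2 : ℝ) ^ n with ht
  have ht0 : ∀ n, 0 ≤ t n := fun n => add_nonneg (sVal_nonneg T n) (by positivity)
  have hta : Antitone t := (sVal_antitone T).add (pow_right_anti₀ (by norm_num) (by norm_num))
  have hts : Summable t := Summable.add hT (summable_geometric_of_lt_one (by norm_num) (by norm_num))
  have hcond : Summable fun k : ℕ => 2 ^ k * t (2 ^ k) :=
    (summable_condensed_iff_of_nonneg ht0 (fun m n _ h => hta h)).2 hts
  have hex : ∀ n : ℕ, ∃ R : l2 →L[ℂ] l2, (R : l2 →ₗ[ℂ] l2).rank ≤ (n : Cardinal) ∧ ‖T - R‖ ≤ t n :=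
    fun n => exists_approx T n (by positivity)
  choose R hRrank hRn using hex
  have hstep : ∀ k : ℕ, ∫⁻ z in Metric.ball (0 : ℂ) 1, ‖GT (R (2 ^ (k + 1)) - R (2 ^ k)) z‖ₑ
      ≤ ENNReal.ofReal (12 * π * (2 ^ k * t (2 ^ k))) := by
    intro k
    have hrank : ((R (2 ^ (k + 1)) - R (2 ^ k) : l2 →L[ℂ] l2) : l2 →ₗ[ℂ] l2).rank
        ≤ ((3 * 2 ^ k : ℕ) : Cardinal) := by
      have e : ((R (2 ^ (k + 1)) - R (2 ^ k) : l2 →L[ℂ] l2) : l2 →ₗ[ℂ] l2)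
          = (R (2 ^ (k + 1)) : l2 →ₗ[ℂ] l2) + (-LinearMap.id) ∘ₗ (R (2 ^ k) : l2 →ₗ[ℂ] l2) := by
        ext1 x
        simp [sub_eq_add_neg]
      rw [e]
      refine (LinearMap.rank_add_le _ _).trans ?_
      refine (add_le_add (hRrank _) ((LinearMap.rank_comp_le_right _ _).trans (hRrank _))).trans ?_
      rw [← Nat.cast_add]
      refine Nat.cast_le.2 ?_
      rw [pow_succ]; omega
    refine (GT_finrank_bound _ _ hrank).trans (ENNReal.ofReal_le_ofReal ?_)
    have hn : ‖R (2 ^ (k + 1)) - R (2 ^ k)‖ ≤ 2 * t (2 ^ k) := by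
      have e : R (2 ^ (k + 1)) - R (2 ^ k) = (T - R (2 ^ k)) - (T - R (2 ^ (k + 1))) := by abel
      rw [e]
      refine (norm_sub_le _ _).trans ?_
      have h1 := hRn (2 ^ k)
      have h2 := (hRn (2 ^ (k + 1))).trans (hta (Nat.pow_le_pow_right (by norm_num) (Nat.le_succ k)))
      linarith
    push_cast
    calc 2 * π * (3 * 2 ^ k * ‖R (2 ^ (k + 1)) - R (2 ^ k)‖)
        ≤ 2 * π * (3 * 2 ^ k * (2 * t (2 ^ k))) := by gcongr
      _ = _ := by ring
  have hadd : ∀ (A B : l2 →L[ℂ] l2) (z : ℂ), GT (A + B) z = GT A z + GT B z := by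
    intro A B z
    simp [GT]
  have hpart : ∀ K : ℕ, ∫⁻ z in Metric.ball (0 : ℂ) 1, ‖GT (R (2 ^ K)) z‖ₑ
      ≤ ENNReal.ofReal (2 * π * ‖R 1‖ + ∑ k ∈ Finset.range K, 12 * π * (2 ^ k * t (2 ^ k))) := by
    intro K
    induction K with
    | zero =>
      have := GT_finrank_bound (R 1) 1 (hRrank 1)
      simpa using this
    | succ K ih =>
      have e : R (2 ^ (K + 1)) = R (2 ^ K) + (R (2 ^ (K + 1)) - R (2 ^ K)) := by abel
      calc ∫⁻ z in Metric.ball (0 : ℂ) 1, ‖GT (R (2 ^ (K + 1))) z‖ₑ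
          ≤ ∫⁻ z in Metric.ball (0 : ℂ) 1, (‖GT (R (2 ^ K)) z‖ₑ
              + ‖GT (R (2 ^ (K + 1)) - R (2 ^ K)) z‖ₑ) := by
            refine lintegral_mono fun z => ?_
            conv_lhs => rw [e, hadd]
            exact enorm_add_le _ _
        _ = _ := lintegral_add_left' (aemeas_enorm (GT_continuousOn _)) _
        _ ≤ _ := add_le_add ih (hstep K)
        _ = _ := by
            have h0 : ∀ k : ℕ, 0 ≤ 12 * π * (2 ^ k * t (2 ^ k)) := fun k =>
              mul_nonneg (by positivity) (mul_nonneg (by positivity) (ht0 _))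
            rw [Finset.sum_range_succ, ← add_assoc]
            exact (ENNReal.ofReal_add (add_nonneg (by positivity)
              (Finset.sum_nonneg fun k _ => h0 k)) (h0 K)).symm
  refine ⟨2 * π * ‖R 1‖ + ∑' k, 12 * π * (2 ^ k * t (2 ^ k)), ?_⟩
  refine fatou_ball (F := fun K z => ‖GT (R (2 ^ K)) z‖ₑ) (fun K => aemeas_enorm (GT_continuousOn _)) ?_ ?_
  · intro z _
    refine (continuous_enorm.tendsto _).comp ?_
    have hlim : Filter.Tendsto (fun K : ℕ => R (2 ^ K)) Filter.atTop (nhds T) := by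
      rw [tendsto_iff_norm_sub_tendsto_zero]
      refine squeeze_zero (fun _ => norm_nonneg _) (fun K => ?_)
        (hts.tendsto_atTop_zero.comp (tendsto_pow_atTop_atTop_of_one_lt (by norm_num : 1 < 2)))
      rw [norm_sub_rev]; exact hRn _
    have hc : Continuous fun A : l2 →L[ℂ] l2 => GT A z := by
      unfold GT
      fun_prop
    exact (hc.tendsto T).comp hlim
  · intro K
    refine (hpart K).trans (ENNReal.ofReal_le_ofReal ?_)
    gcongr
    exact (hcond.mul_left (12 * π)).sum_le_tsum _ fun k _ =>
      mul_nonneg (by positivity) (mul_nonneg (by positivity) (ht0 _))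

lemma forward_dir (a : ℕ → ℂ) (ha : ∀ z : ℂ, ‖z‖ < 1 → Summable fun j : ℕ => a j * z ^ j)
    (T : l2 →L[ℂ] l2) (hT : ∀ j k : ℕ, (T (lp.single 2 k 1)) j = a (j + k))
    (htr : MemTraceClass T) :
    IntegrableOn (iteratedDeriv 2 (fun ζ : ℂ => ∑' j : ℕ, a j * ζ ^ j))
          (Metric.ball (0 : ℂ) 1) volume := by
  have heq : Set.EqOn (iteratedDeriv 2 (fun ζ : ℂ => ∑' j : ℕ, a j * ζ ^ j))
      (fun z => 2 * GT T z) (Metric.ball (0 : ℂ) 1) := by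
    intro z hz
    have hz' : ‖z‖ < 1 := by simpa using hz
    simp only
    rw [ps_iteratedDeriv ha hz', GT_hankel hT hz']
  rw [integrableOn_congr_fun heq Metric.isOpen_ball.measurableSet]
  refine Integrable.const_mul ?_ 2
  refine ⟨(GT_continuousOn T).aestronglyMeasurable Metric.isOpen_ball.measurableSet, ?_⟩
  obtain ⟨M, hM⟩ := GT_traceClass_bound htr
  exact hM.trans_lt ENNReal.ofReal_lt_top


/-! ### Integrability implies trace class -/

lemma repro_ball {b : ℕ → ℂ} (hb : ∀ z : ℂ, ‖z‖ < 1 → Summable fun j : ℕ => b j * z ^ j)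
    {ρ : ℝ} (hρ0 : 0 ≤ ρ) (hρ1 : ρ < 1) (k : ℕ) :
    ∫ z in Metric.ball (0 : ℂ) ρ, (∑' j, b j * z ^ j) * ((1 - (‖z‖ : ℂ) ^ 2) * conj z ^ k)
      = b k * ((π : ℂ) * (ρ ^ (2 * k + 2) / (k + 1) - ρ ^ (2 * k + 4) / (k + 2))) := by
  have hs := ps_summable_norm hb hρ0 hρ1
  have hfin : IsFiniteMeasure (volume.restrict (Metric.ball (0 : ℂ) ρ)) :=
    ⟨by rw [Measure.restrict_apply_univ]; exact measure_ball_lt_top⟩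
  have hmem : ∀ᵐ z ∂(volume.restrict (Metric.ball (0 : ℂ) ρ)), ‖z‖ < ρ := by
    filter_upwards [ae_restrict_mem Metric.isOpen_ball.measurableSet] with z hz
    simpa using hz
  have h := hasSum_integral_of_dominated_convergence (μ := volume.restrict (Metric.ball (0 : ℂ) ρ))
    (F := fun (j : ℕ) (z : ℂ) => b j * ((1 - (‖z‖ : ℂ) ^ 2) * (z ^ j * conj z ^ k)))
    (f := fun z => (∑' j, b j * z ^ j) * ((1 - (‖z‖ : ℂ) ^ 2) * conj z ^ k))
    (fun j _ => ‖b j‖ * ρ ^ j)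
    (fun j => by
      have : Continuous fun z : ℂ => b j * ((1 - (‖z‖ : ℂ) ^ 2) * (z ^ j * conj z ^ k)) := by fun_prop
      exact this.aestronglyMeasurable)
    (fun j => by
      filter_upwards [hmem] with z hz
      have hz1 : ‖z‖ ≤ 1 := (hz.trans hρ1).le
      have h1 : ‖(1 - (‖z‖ : ℂ) ^ 2)‖ ≤ 1 := by
        have e : (1 - (‖z‖ : ℂ) ^ 2) = ((1 - ‖z‖ ^ 2 : ℝ) : ℂ) := by push_cast; rfl
        have h2 : ‖z‖ ^ 2 ≤ 1 := pow_le_one₀ (norm_nonneg z) hz1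
        rw [e, Complex.norm_real, Real.norm_of_nonneg (by linarith)]
        linarith [sq_nonneg ‖z‖]
      rw [norm_mul, norm_mul, norm_mul, norm_pow, norm_pow, RCLike.norm_conj]
      have h3 : ‖z‖ ^ k ≤ 1 := pow_le_one₀ (norm_nonneg z) hz1
      have h4 : ‖z‖ ^ j ≤ ρ ^ j := pow_le_pow_left₀ (norm_nonneg z) hz.le j
      calc ‖b j‖ * (‖(1 - (‖z‖ : ℂ) ^ 2)‖ * (‖z‖ ^ j * ‖z‖ ^ k))
          ≤ ‖b j‖ * (1 * (ρ ^ j * 1)) := by gcongr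
        _ = _ := by ring)
    (Filter.Eventually.of_forall fun z => hs)
    (integrable_const _)
    (by
      filter_upwards [hmem] with z hz
      have h1 := (hb z (hz.trans hρ1)).hasSum.mul_right ((1 - (‖z‖ : ℂ) ^ 2) * conj z ^ k)
      have e : (fun j : ℕ => b j * ((1 - (‖z‖ : ℂ) ^ 2) * (z ^ j * conj z ^ k)))
          = fun j : ℕ => b j * z ^ j * ((1 - (‖z‖ : ℂ) ^ 2) * conj z ^ k) := by
        funext j; ring
      rw [e]
      exact h1)
  simp_rw [integral_const_mul, ball_moment_weight hρ0] at h
  have h2 := hasSum_single (f := fun j : ℕ => b j * (if j = k then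
    (π : ℂ) * (ρ ^ (2 * k + 2) / (k + 1) - ρ ^ (2 * k + 4) / (k + 2)) else 0)) k
    (by intro j hj; simp [hj])
  have h3 := h.unique h2
  rw [h3, if_pos rfl]

lemma repro {b : ℕ → ℂ} (hb : ∀ z : ℂ, ‖z‖ < 1 → Summable fun j : ℕ => b j * z ^ j)
    (hDint : IntegrableOn (fun z : ℂ => ∑' j, b j * z ^ j) (Metric.ball (0 : ℂ) 1)) (k : ℕ) :
    IntegrableOn (fun z => (∑' j, b j * z ^ j) * ((1 - (‖z‖ : ℂ) ^ 2) * conj z ^ k)) (Metric.ball (0 : ℂ) 1) ∧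
    ∫ z in Metric.ball (0 : ℂ) 1, (∑' j, b j * z ^ j) * ((1 - (‖z‖ : ℂ) ^ 2) * conj z ^ k)
      = π * (b k / ((k + 1) * (k + 2))) := by
  have hI : IntegrableOn (fun z => (∑' j, b j * z ^ j) * ((1 - (‖z‖ : ℂ) ^ 2) * conj z ^ k))
      (Metric.ball (0 : ℂ) 1) := by
    refine Integrable.mul_bdd (c := 1) hDint ?_ ?_
    · have : Continuous fun z : ℂ => (1 - (‖z‖ : ℂ) ^ 2) * conj z ^ k := by fun_prop
      exact this.aestronglyMeasurable
    · filter_upwards [ae_restrict_mem Metric.isOpen_ball.measurableSet] with z hz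
      have hz1 : ‖z‖ ≤ 1 := (show ‖z‖ < 1 by simpa using hz).le
      have h1 : ‖(1 - (‖z‖ : ℂ) ^ 2)‖ ≤ 1 := by
        have e : (1 - (‖z‖ : ℂ) ^ 2) = ((1 - ‖z‖ ^ 2 : ℝ) : ℂ) := by push_cast; rfl
        have h2 : ‖z‖ ^ 2 ≤ 1 := pow_le_one₀ (norm_nonneg z) hz1
        rw [e, Complex.norm_real, Real.norm_of_nonneg (by linarith)]
        linarith [sq_nonneg ‖z‖]
      rw [norm_mul, norm_pow, RCLike.norm_conj]
      have h3 : ‖z‖ ^ k ≤ 1 := pow_le_one₀ (norm_nonneg z) hz1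
      exact mul_le_one₀ h1 (by positivity) h3
  refine ⟨hI, ?_⟩
  set ρ : ℕ → ℝ := fun m => 1 - 1 / ((m : ℝ) + 1) with hρ
  have hρ0 : ∀ m, 0 ≤ ρ m := fun m => by
    simp only [hρ]
    rw [sub_nonneg, div_le_one (by positivity)]
    linarith [(m.cast_nonneg : (0 : ℝ) ≤ m)]
  have hρ1 : ∀ m, ρ m < 1 := fun m => by
    simp only [hρ]
    have : (0 : ℝ) < 1 / (m + 1) := by positivity
    linarith
  have hρlim : Filter.Tendsto ρ Filter.atTop (nhds 1) := by
    have h := (tendsto_one_div_add_atTop_nhds_zero_nat (𝕜 := ℝ)).const_sub (1 : ℝ)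
    rw [sub_zero] at h
    exact h
  have hρmono : Monotone ρ := by
    intro m n hmn
    simp only [hρ]
    gcongr
  have hU : ⋃ m, Metric.ball (0 : ℂ) (ρ m) = Metric.ball 0 1 := by
    ext z
    simp only [Set.mem_iUnion, mem_ball_zero_iff]
    constructor
    · rintro ⟨m, hm⟩; exact hm.trans (hρ1 m)
    · intro hz
      exact (hρlim.eventually_const_lt hz).exists
  have h1 := tendsto_setIntegral_of_monotone (μ := volume) (s := fun m => Metric.ball (0 : ℂ) (ρ m))
    (fun m => Metric.isOpen_ball.measurableSet)
    (fun m n hmn => Metric.ball_subset_ball (hρmono hmn)) (by rw [hU]; exact hI)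
  rw [hU] at h1
  simp_rw [repro_ball hb (hρ0 _) (hρ1 _)] at h1
  have h2 : Filter.Tendsto (fun m : ℕ => b k * ((π : ℂ) * ((ρ m : ℂ) ^ (2 * k + 2) / (k + 1)
      - (ρ m : ℂ) ^ (2 * k + 4) / (k + 2)))) Filter.atTop
      (nhds (b k * ((π : ℂ) * (((1 : ℝ) : ℂ) ^ (2 * k + 2) / (k + 1)
      - ((1 : ℝ) : ℂ) ^ (2 * k + 4) / (k + 2))))) := by
    have hc : Continuous fun r : ℝ => b k * ((π : ℂ) * ((r : ℂ) ^ (2 * k + 2) / (k + 1)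
      - (r : ℂ) ^ (2 * k + 4) / (k + 2))) := by fun_prop
    exact (hc.tendsto 1).comp hρlim
  rw [tendsto_nhds_unique h1 h2]
  have : (k + 1 : ℂ) ≠ 0 := by exact_mod_cast k.succ_ne_zero
  have : (k + 2 : ℂ) ≠ 0 := by exact_mod_cast (by omega : k + 2 ≠ 0)
  simp only [Complex.ofReal_one, one_pow]
  field_simp
  ring

/-- The kernel vectors. -/
abbrev kv (z : ℂ) : l2 := hvec (fun _ => 1) z

lemma one_wt_le : ∀ k : ℕ, |(fun _ => (1 : ℝ)) k| ≤ k + 1 := by intro k; simp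

/-- The operator valued integrand. -/
def Phi (D : ℂ → ℂ) (z : ℂ) : l2 →L[ℂ] l2 :=
  ((π : ℂ)⁻¹ * (D z * (1 - (‖z‖ : ℂ) ^ 2))) • InnerProductSpace.rankOne ℂ (kv (conj z)) (kv z)

lemma kv_norm_mul {z : ℂ} (hz : ‖z‖ < 1) :
    ‖(1 - (‖z‖ : ℂ) ^ 2)‖ * (‖kv (conj z)‖ * ‖kv z‖) = 1 := by
  have h1 := hvec_one_norm_sq hz
  have h2 := hvec_one_norm_sq (z := conj z) (by simpa using hz)
  rw [RCLike.norm_conj] at h2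
  have h3 : ‖kv (conj z)‖ = ‖kv z‖ := by
    have := h2.trans h1.symm
    exact (pow_left_inj₀ (norm_nonneg _) (norm_nonneg _) two_ne_zero).1 this
  have hpos : 0 < 1 - ‖z‖ ^ 2 := by nlinarith [norm_nonneg z]
  have e : (1 - (‖z‖ : ℂ) ^ 2) = ((1 - ‖z‖ ^ 2 : ℝ) : ℂ) := by push_cast; rfl
  rw [h3, ← sq, h1, e, Complex.norm_real, Real.norm_of_nonneg hpos.le, mul_inv_cancel₀ hpos.ne']

lemma Phi_diag_le (D : ℂ → ℂ) {z : ℂ} (hz : ‖z‖ < 1) {n : ℕ} {e f : Fin n → l2}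
    (he : Orthonormal ℂ e) (hf : Orthonormal ℂ f) :
    ∑ i, ‖inner ℂ (e i) (Phi D z (f i))‖ ≤ π⁻¹ * ‖D z‖ := by
  have h := rankOne_diag_le (kv (conj z)) (kv z) he hf
  have h1 : ∀ i, ‖inner ℂ (e i) (Phi D z (f i))‖ = π⁻¹ * ‖D z‖ * ‖(1 - (‖z‖ : ℂ) ^ 2)‖ *
      ‖inner ℂ (e i) (InnerProductSpace.rankOne ℂ (kv (conj z)) (kv z) (f i))‖ := by
    intro i
    rw [Phi, smul_apply, inner_smul_right, norm_mul, norm_mul, norm_mul, norm_inv,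
      Complex.norm_real, Real.norm_of_nonneg pi_pos.le]
    ring
  simp_rw [h1]
  rw [← Finset.mul_sum]
  calc _ ≤ π⁻¹ * ‖D z‖ * ‖(1 - (‖z‖ : ℂ) ^ 2)‖ * (‖kv (conj z)‖ * ‖kv z‖) := by
        have := pi_pos
        gcongr
    _ = _ := by rw [mul_assoc, kv_norm_mul hz, mul_one]

lemma Phi_norm (D : ℂ → ℂ) {z : ℂ} (hz : ‖z‖ < 1) : ‖Phi D z‖ = π⁻¹ * ‖D z‖ := by
  rw [Phi, norm_smul, InnerProductSpace.norm_rankOne, norm_mul, norm_mul, norm_inv,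
    Complex.norm_real, Real.norm_of_nonneg pi_pos.le]
  have := kv_norm_mul hz
  linear_combination (π⁻¹ * ‖D z‖) * this

lemma rankOne_cont :
    Continuous fun p : l2 × l2 => (InnerProductSpace.rankOne ℂ p.1 p.2 : l2 →L[ℂ] l2) := by
  rw [continuous_iff_continuousAt]
  intro q
  rw [ContinuousAt, tendsto_iff_norm_sub_tendsto_zero]
  have hlim : Filter.Tendsto (fun p : l2 × l2 => ‖p.1 - q.1‖ * ‖p.2‖ + ‖q.1‖ * ‖p.2 - q.2‖)
      (nhds q) (nhds (‖q.1 - q.1‖ * ‖q.2‖ + ‖q.1‖ * ‖q.2 - q.2‖)) := by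
    have hc : Continuous fun p : l2 × l2 => ‖p.1 - q.1‖ * ‖p.2‖ + ‖q.1‖ * ‖p.2 - q.2‖ := by
      fun_prop
    exact hc.tendsto q
  have hzero : ‖q.1 - q.1‖ * ‖q.2‖ + ‖q.1‖ * ‖q.2 - q.2‖ = 0 := by simp
  rw [hzero] at hlim
  refine squeeze_zero (fun p => norm_nonneg _) (fun p => ?_) hlim
  have e : (InnerProductSpace.rankOne ℂ p.1 p.2 : l2 →L[ℂ] l2) - InnerProductSpace.rankOne ℂ q.1 q.2
      = InnerProductSpace.rankOne ℂ (p.1 - q.1) p.2 + InnerProductSpace.rankOne ℂ q.1 (p.2 - q.2) := by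
    rw [map_sub, map_sub, sub_apply]
    abel
  rw [e]
  refine (norm_add_le _ _).trans ?_
  rw [InnerProductSpace.norm_rankOne, InnerProductSpace.norm_rankOne]

lemma kv_conj_cont : ContinuousOn (fun z : ℂ => kv (conj z)) (Metric.ball 0 1) :=
  hvec_conj_continuousOn one_wt_le

lemma kv_cont : ContinuousOn (fun z : ℂ => kv z) (Metric.ball 0 1) := hvec_continuousOn one_wt_le

lemma kv_rankOne_cont :
    ContinuousOn (fun z : ℂ => (InnerProductSpace.rankOne ℂ (kv (conj z)) (kv z) : l2 →L[ℂ] l2))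
      (Metric.ball (0 : ℂ) 1) :=
  Continuous.comp_continuousOn (f := fun z : ℂ => (kv (conj z), kv z)) rankOne_cont
    (kv_conj_cont.prodMk kv_cont)

lemma Phi_continuousOn {D : ℂ → ℂ} (hD : ContinuousOn D (Metric.ball 0 1)) :
    ContinuousOn (Phi D) (Metric.ball 0 1) := by
  have h2 : ContinuousOn (fun z : ℂ => (π : ℂ)⁻¹ * (D z * (1 - (‖z‖ : ℂ) ^ 2))) (Metric.ball 0 1) := by
    refine continuousOn_const.mul (hD.mul ?_)
    fun_prop
  exact h2.smul kv_rankOne_cont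

lemma Phi_integrable {D : ℂ → ℂ} (hD : ContinuousOn D (Metric.ball 0 1))
    (hDint : IntegrableOn D (Metric.ball (0 : ℂ) 1)) :
    IntegrableOn (Phi D) (Metric.ball (0 : ℂ) 1) := by
  refine Integrable.mono' (hDint.norm.const_mul π⁻¹)
    ((Phi_continuousOn hD).aestronglyMeasurable Metric.isOpen_ball.measurableSet) ?_
  filter_upwards [ae_restrict_mem Metric.isOpen_ball.measurableSet] with z hz
  exact (Phi_norm D (by simpa using hz)).le

lemma Phi_pair {D : ℂ → ℂ} (hΦ : IntegrableOn (Phi D) (Metric.ball (0 : ℂ) 1)) (x y : l2) :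
    IntegrableOn (fun z => inner ℂ x (Phi D z y)) (Metric.ball (0 : ℂ) 1) ∧
    inner ℂ x ((∫ z in Metric.ball (0 : ℂ) 1, Phi D z) y)
      = ∫ z in Metric.ball (0 : ℂ) 1, inner ℂ x (Phi D z y) := by
  set L : (l2 →L[ℂ] l2) →L[ℂ] ℂ := (innerSL ℂ x) ∘L (ContinuousLinearMap.apply ℂ l2 y) with hL
  have h := L.integral_comp_comm hΦ
  have h2 := L.integrable_comp hΦ
  exact ⟨h2, h.symm⟩

lemma Phi_nuc {D : ℂ → ℂ} (hΦ : IntegrableOn (Phi D) (Metric.ball (0 : ℂ) 1))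
    (hDint : IntegrableOn D (Metric.ball (0 : ℂ) 1)) :
    Nuc (∫ z in Metric.ball (0 : ℂ) 1, Phi D z) := by
  refine ⟨∫ z in Metric.ball (0 : ℂ) 1, π⁻¹ * ‖D z‖, fun n e f he hf => ?_⟩
  calc ∑ i, ‖inner ℂ (e i) ((∫ z in Metric.ball (0 : ℂ) 1, Phi D z) (f i))‖
      ≤ ∑ i, ∫ z in Metric.ball (0 : ℂ) 1, ‖inner ℂ (e i) (Phi D z (f i))‖ := by
        refine Finset.sum_le_sum fun i _ => ?_
        rw [(Phi_pair hΦ _ _).2]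
        exact norm_integral_le_integral_norm _
    _ = ∫ z in Metric.ball (0 : ℂ) 1, ∑ i, ‖inner ℂ (e i) (Phi D z (f i))‖ :=
        (integral_finsetSum _ fun i _ => (Phi_pair hΦ _ _).1.norm).symm
    _ ≤ _ := by
        refine setIntegral_mono_on (integrable_finsetSum _ fun i _ => (Phi_pair hΦ _ _).1.norm)
          (hDint.norm.const_mul _) Metric.isOpen_ball.measurableSet fun z hz => ?_
        exact Phi_diag_le D (by simpa using hz) he hf

lemma Phi_entry (D : ℂ → ℂ) (z : ℂ) (j k : ℕ) :
    inner ℂ (lp.single 2 j (1 : ℂ) : l2) (Phi D z (lp.single 2 k 1))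
      = ((π : ℂ)⁻¹ * (D z * (1 - (‖z‖ : ℂ) ^ 2))) * (conj (kv z k) * kv (conj z) j) := by
  rw [Phi, smul_apply, inner_smul_right, InnerProductSpace.rankOne_apply,
    inner_smul_right, lp.inner_single_left, lp.inner_single_right]
  simp

lemma single_apply' (j k : ℕ) : (lp.single 2 k (1 : ℂ) : l2) j = if j = k then 1 else 0 := by
  rw [lp.coeFn_single, Pi.single_apply]

lemma backward_dir (a : ℕ → ℂ) (ha : ∀ z : ℂ, ‖z‖ < 1 → Summable fun j : ℕ => a j * z ^ j)
    (hint0 : IntegrableOn (iteratedDeriv 2 (fun ζ : ℂ => ∑' j : ℕ, a j * ζ ^ j))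
          (Metric.ball (0 : ℂ) 1) volume) :
    ∃ T : l2 →L[ℂ] l2,
        (∀ j k : ℕ, (T (lp.single 2 k 1)) j = a (j + k)) ∧ MemTraceClass T := by
  set b : ℕ → ℂ := fun n => (n + 1 : ℂ) * (n + 2) * a (n + 2) with hbdef
  have hb : ∀ z : ℂ, ‖z‖ < 1 → Summable fun j : ℕ => b j * z ^ j := ps_dd_summable ha
  set D : ℂ → ℂ := fun z => ∑' j, b j * z ^ j with hD
  have heq : Set.EqOn (iteratedDeriv 2 (fun ζ : ℂ => ∑' j : ℕ, a j * ζ ^ j)) D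
      (Metric.ball (0 : ℂ) 1) := fun z hz => ps_iteratedDeriv ha (by simpa using hz)
  have hDint : IntegrableOn D (Metric.ball (0 : ℂ) 1) := by
    rwa [integrableOn_congr_fun heq Metric.isOpen_ball.measurableSet] at hint0
  have hDc : ContinuousOn D (Metric.ball 0 1) := ps_continuousOn hb
  have hΦ := Phi_integrable hDc hDint
  set T' : l2 →L[ℂ] l2 := ∫ z in Metric.ball (0 : ℂ) 1, Phi D z with hT'
  have hnuc : Nuc T' := Phi_nuc hΦ hDint
  have hentry0 : ∀ j k : ℕ, (T' (lp.single 2 k 1)) j = ∫ z in Metric.ball (0 : ℂ) 1,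
      ((π : ℂ)⁻¹ * (D z * (1 - (‖z‖ : ℂ) ^ 2))) * (conj (kv z k) * kv (conj z) j) := by
    intro j k
    have h := (Phi_pair hΦ (lp.single 2 j 1) (lp.single 2 k 1)).2
    rw [lp.inner_single_left] at h
    simp_rw [Phi_entry] at h
    rw [← h]
    simp [hT']
  have hentry : ∀ j k : ℕ, (T' (lp.single 2 (k + 1) 1)) (j + 1) = a (j + k + 2) := by
    intro j k
    rw [hentry0]
    have e : ∫ z in Metric.ball (0 : ℂ) 1,
        ((π : ℂ)⁻¹ * (D z * (1 - (‖z‖ : ℂ) ^ 2))) * (conj (kv z (k + 1)) * kv (conj z) (j + 1))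
        = ∫ z in Metric.ball (0 : ℂ) 1, (π : ℂ)⁻¹ *
          ((∑' j, b j * z ^ j) * ((1 - (‖z‖ : ℂ) ^ 2) * conj z ^ (j + k))) := by
      refine setIntegral_congr_fun Metric.isOpen_ball.measurableSet fun z hz => ?_
      have hz' : ‖z‖ < 1 := by simpa using hz
      simp only [hD]
      rw [kv, kv, hvec_coord one_wt_le hz', hvec_coord one_wt_le (by simpa using hz')]
      simp only [Complex.ofReal_one, one_mul, map_pow, pow_add]
      ring
    rw [e, integral_const_mul, (repro hb hDint (j + k)).2, hbdef]
    have h0 : (π : ℂ) ≠ 0 := by exact_mod_cast pi_ne_zero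
    have h1 : (((j + k : ℕ) : ℂ) + 1) ≠ 0 := by exact_mod_cast (by omega : j + k + 1 ≠ 0)
    have h2 : (((j + k : ℕ) : ℂ) + 2) ≠ 0 := by exact_mod_cast (by omega : j + k + 2 ≠ 0)
    field_simp
  have hentryl : ∀ k : ℕ, (T' (lp.single 2 k 1)) 0 = 0 := by
    intro k
    rw [hentry0]
    refine setIntegral_eq_zero_of_forall_eq_zero fun z hz => ?_
    have hz' : ‖conj z‖ < 1 := by simpa using hz
    rw [kv, kv, hvec_coord_zero one_wt_le hz', mul_zero, mul_zero]
  have hentryr : ∀ j : ℕ, (T' (lp.single 2 0 1)) j = 0 := by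
    intro j
    rw [hentry0]
    refine setIntegral_eq_zero_of_forall_eq_zero fun z hz => ?_
    have hz' : ‖z‖ < 1 := by simpa using hz
    rw [kv, kv, hvec_coord_zero one_wt_le hz', map_zero, zero_mul, mul_zero]
  have hsq : Summable fun j : ℕ => ‖a j‖ ^ 2 := by
    rw [← summable_nat_add_iff 2]
    have h := (lp.memℓp (T' (lp.single 2 1 1))).summable (by norm_num)
    rw [← summable_nat_add_iff 1] at h
    simp only [ENNReal.toReal_ofNat, Real.rpow_two] at h
    have e : (fun j : ℕ => ‖a (j + 2)‖ ^ 2) = fun j => ‖(T' (lp.single 2 1 1)) (j + 1)‖ ^ 2 := by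
      funext j
      have := hentry j 0
      simp only [zero_add, add_zero] at this
      rw [this]
    rw [e]
    exact h
  have hmem : ∀ c : ℕ → ℂ, (∀ j, ‖c j‖ = ‖a j‖) → Memℓp c 2 := by
    intro c hc
    refine memℓp_gen ?_
    simp only [ENNReal.toReal_ofNat, Real.rpow_two, hc]
    exact hsq
  set r : l2 := ⟨a, hmem a fun _ => rfl⟩ with hr
  set rc : l2 := ⟨fun j => conj (a j), hmem _ fun j => RCLike.norm_conj _⟩ with hrc
  refine ⟨T' + InnerProductSpace.rankOne ℂ (lp.single 2 0 1) rc
    + InnerProductSpace.rankOne ℂ (r - a 0 • lp.single 2 0 1) (lp.single 2 0 1), ?_,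
    ((hnuc.add (Nuc.rankOne _ _)).add (Nuc.rankOne _ _)).memTraceClass⟩
  have hrj : ∀ j, r j = a j := fun _ => rfl
  have hrcj : ∀ j, rc j = conj (a j) := fun _ => rfl
  intro j k
  simp only [add_apply, InnerProductSpace.rankOne_apply, lp.coeFn_add, Pi.add_apply, lp.coeFn_smul,
    Pi.smul_apply, lp.coeFn_sub, Pi.sub_apply, lp.inner_single_right, hrj, hrcj, single_apply',
    smul_eq_mul]
  rcases j with _ | j
  · rcases k with _ | k
    · rw [hentryl]; simp
    · rw [hentryl]; simp
  · rcases k with _ | k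
    · rw [hentryr]; simp
    · rw [hentry]; simp; ring_nf

/-- For `α` holomorphic on 𝔻, the Hankel matrix `Γ_α` is of trace class
iff `∫_𝔻 |α''(ζ)| dm₂(ζ) < ∞`. -/
theorem hankel_traceClass_iff_secondDerivative_integrable
    (a : ℕ → ℂ) (ha : ∀ z : ℂ, ‖z‖ < 1 → Summable fun j : ℕ => a j * z ^ j) :
    (∃ T : l2 →L[ℂ] l2,
        (∀ j k : ℕ, (T (lp.single 2 k 1)) j = a (j + k)) ∧ MemTraceClass T)
      ↔ IntegrableOn (iteratedDeriv 2 (fun ζ : ℂ => ∑' j : ℕ, a j * ζ ^ j))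
          (Metric.ball (0 : ℂ) 1) volume := by
  constructor
  · rintro ⟨T, hT, htr⟩
    exact forward_dir a ha T hT htr
  · exact backward_dir a ha

end
end

section
/- For every integer n ≥ 0 and every t > 0, ∫_ℝ e^{−2πist} (1/√π) ((s − i)/(s + i))^n (s + i)^{−1} ds = −2√π i L_n(4πt) e^{−2πt}, where L_n is the n-th Laguerre polynomial L_n(s) = (1/n!) e^s (d/ds)^n (e^{−s} s^n). (Here (1/√π)((s−i)/(s+i))^n (s+i)^{−1} is the image of z^n ∈ L²(𝕋) under the unitary map 𝒰 : L²(𝕋) → L²(ℝ), (𝒰f)(s) = (1/√π) f(ω^{−1}(s)) / (s+i), with ω(ζ) = i(1+ζ)/(1−ζ).) -/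
open MeasureTheory Complex Real Filter

noncomputable section

/-- The `n`-th Laguerre polynomial, via the Rodrigues formula
`L_n(s) = (1/n!) e^s (d/ds)^n (e^{−s} s^n)`. -/
noncomputable def laguerre (n : ℕ) (s : ℝ) : ℝ :=
  (1 / (n.factorial : ℝ)) * Real.exp s *
    iteratedDeriv n (fun u : ℝ => Real.exp (-u) * u ^ n) s

lemma aux_lag (n : ℕ) (x : ℝ) : laguerre n x =
    ∑ k ∈ Finset.range (n+1), (n.choose k : ℝ) * (-x) ^ k / (k.factorial : ℝ) := by
  unfold laguerre
  have h1 : (fun u : ℝ => Real.exp (-u) * u ^ n) = fun u => Real.exp ((-1) * u) * u ^ n := by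
    ext u; simp
  rw [h1, iteratedDeriv_fun_mul (by fun_prop) (by fun_prop), Finset.mul_sum]
  refine Finset.sum_congr rfl fun k hk => ?_
  have hk' : k ≤ n := by simpa [Nat.lt_succ_iff] using hk
  rw [iteratedDeriv_exp_const_mul, iteratedDeriv_pow]
  have h2 : ((n.descFactorial (n-k) : ℕ) : ℝ) = n.factorial / k.factorial := by
    rw [eq_div_iff (by positivity)]
    have := Nat.factorial_mul_descFactorial (Nat.sub_le n k)
    rw [Nat.sub_sub_self hk'] at this
    rw [mul_comm]
    exact_mod_cast this
  rw [h2, Nat.sub_sub_self hk']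
  have : Real.exp x * Real.exp (-1 * x) = 1 := by rw [← Real.exp_add]; simp
  have hf : (n.factorial : ℝ) ≠ 0 := by positivity
  calc _ = (Real.exp x * Real.exp (-1 * x)) * ((n.factorial : ℝ) / n.factorial) * ((n.choose k : ℝ) * ((-1)^k * x ^ k) / (k.factorial : ℝ)) := by ring
    _ = _ := by rw [this, div_self hf, ← mul_pow]; simp

lemma aux_ne (s : ℝ) : (s : ℂ) + Complex.I ≠ 0 := by
  intro h
  have := congrArg Complex.im h
  simp at this

/-- the truncated integrals -/
def JJ (t : ℝ) (k : ℕ) (R : ℝ) : ℂ := ∫ s in (-R)..R,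
  Complex.exp (-(2 * (π : ℂ) * (s : ℂ) * (t : ℂ)) * Complex.I) * (((s : ℂ) + Complex.I) ^ (k+1))⁻¹

lemma aux_cont (t : ℝ) (k : ℕ) : Continuous fun s : ℝ =>
  Complex.exp (-(2 * (π : ℂ) * (s : ℂ) * (t : ℂ)) * Complex.I) * (((s : ℂ) + Complex.I) ^ (k+1))⁻¹ := by
  refine Continuous.mul (by fun_prop) (Continuous.inv₀ (by fun_prop) fun s => pow_ne_zero _ (aux_ne s))

lemma aux_norm (t s : ℝ) : ‖Complex.exp (-(2 * (π : ℂ) * (s : ℂ) * (t : ℂ)) * Complex.I)‖ = 1 := by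
  rw [Complex.norm_exp]; simp

lemma aux_bdry (t : ℝ) (k : ℕ) (l : Filter ℝ) (hl : Tendsto (fun s : ℝ => |s|) l atTop) : Tendsto (fun s : ℝ =>
    Complex.exp (-(2 * (π : ℂ) * (s : ℂ) * (t : ℂ)) * Complex.I) * (((s : ℂ) + Complex.I) ^ (k+1))⁻¹)
    l (nhds 0) := by
  rw [tendsto_zero_iff_norm_tendsto_zero]
  simp only [norm_mul, aux_norm, one_mul, norm_inv, norm_pow]
  refine Tendsto.inv_tendsto_atTop ?_
  refine (tendsto_pow_atTop (by omega)).comp ?_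
  refine tendsto_atTop_mono (fun s => ?_) hl
  have := Complex.abs_re_le_norm ((s : ℂ) + Complex.I)
  simpa using this

lemma aux_ibp (t : ℝ) (k : ℕ) (R : ℝ) :
    (Complex.exp (-(2 * (π : ℂ) * (R : ℂ) * (t : ℂ)) * Complex.I) * (((R : ℂ) + Complex.I) ^ (k+1))⁻¹)
    - (Complex.exp (-(2 * (π : ℂ) * ((-R : ℝ) : ℂ) * (t : ℂ)) * Complex.I) * ((((-R : ℝ) : ℂ) + Complex.I) ^ (k+1))⁻¹)
    = (-(2 * π * t) * Complex.I) * JJ t k R - (k + 1) * JJ t (k+1) R := by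
  unfold JJ
  rw [← intervalIntegral.integral_const_mul, ← intervalIntegral.integral_const_mul,
    ← intervalIntegral.integral_sub
      (((aux_cont t k).intervalIntegrable _ _).const_mul _)
      (((aux_cont t (k+1)).intervalIntegrable _ _).const_mul _)]
  symm
  refine intervalIntegral.integral_eq_sub_of_hasDerivAt (f := fun s : ℝ =>
    Complex.exp (-(2 * (π : ℂ) * (s : ℂ) * (t : ℂ)) * Complex.I) * (((s : ℂ) + Complex.I) ^ (k+1))⁻¹) (fun s _ => ?_)
    (Continuous.intervalIntegrable ((continuous_const.mul (aux_cont t k)).sub (continuous_const.mul (aux_cont t (k+1)))) _ _)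
  have h0 : HasDerivAt (fun s : ℝ => (s : ℂ)) 1 s := Complex.ofRealCLM.hasDerivAt
  have h1 := ((((h0.const_mul (2 * (π : ℂ))).mul_const (t : ℂ)).neg).mul_const Complex.I).cexp
  have h2 := ((h0.add_const Complex.I).pow (k+1)).inv (pow_ne_zero _ (aux_ne s))
  have h3 := h1.mul h2
  refine h3.congr_deriv ?_
  have := aux_ne s
  simp only [Pi.neg_apply, Pi.pow_apply, Pi.inv_apply]
  push_cast
  field_simp
  ring

lemma aux_ft (s : ℝ) : ∫ x in Set.Ioi (0:ℝ), (x : ℂ) * Complex.exp (-(2 * π * (1 - s * Complex.I)) * x)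
    = -(4 * π ^ 2 * ((s : ℂ) + Complex.I) ^ 2)⁻¹ := by
  set a : ℂ := 2 * π * (1 - s * Complex.I) with ha
  have hare : a.re = 2 * π := by simp [ha]
  have ha0 : a ≠ 0 := by
    intro h; rw [h] at hare; simp at hare
  have hnorm : ∀ x : ℝ, ‖Complex.exp (-a * x)‖ = Real.exp (-(2 * π) * x) := by
    intro x; rw [Complex.norm_exp]; simp [hare]
  have hint : IntegrableOn (fun x : ℝ => (x : ℂ) * Complex.exp (-a * x)) (Set.Ioi 0) := by
    have := integrableOn_rpow_mul_exp_neg_mul_rpow (s := 1) (p := 1) (b := 2 * π) (by norm_num) (by norm_num) (by positivity)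
    refine Integrable.mono' this (by fun_prop) ?_
    filter_upwards [ae_restrict_mem measurableSet_Ioi] with x hx
    rw [norm_mul, hnorm]
    simp [abs_of_pos (Set.mem_Ioi.1 hx)]
  have hexp : Tendsto (fun x : ℝ => Real.exp (-(2 * π) * x)) atTop (nhds 0) := by
    refine Real.tendsto_exp_atBot.comp ?_
    exact tendsto_id.const_mul_atTop_of_neg (by linarith [Real.pi_pos])
  have hxexp : Tendsto (fun x : ℝ => x * Real.exp (-(2 * π) * x)) atTop (nhds 0) := by
    have := tendsto_rpow_mul_exp_neg_mul_atTop_nhds_zero 1 (2 * π) (by positivity)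
    simpa using this
  have hlim : Tendsto (fun x : ℝ => -((x : ℂ) / a + 1 / a ^ 2) * Complex.exp (-a * x)) atTop (nhds 0) := by
    have e1 : Tendsto (fun x : ℝ => Complex.exp (-a * x)) atTop (nhds 0) := by
      rw [tendsto_zero_iff_norm_tendsto_zero]; simpa only [hnorm] using hexp
    have e2 : Tendsto (fun x : ℝ => (x : ℂ) * Complex.exp (-a * x)) atTop (nhds 0) := by
      rw [tendsto_zero_iff_norm_tendsto_zero]
      refine hxexp.congr' ?_
      filter_upwards [eventually_gt_atTop 0] with x hx
      rw [norm_mul, hnorm]; simp [abs_of_pos hx]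
    have := (e2.const_mul (-1 / a)).add (e1.const_mul (-1 / a ^ 2))
    simp only [mul_zero, add_zero] at this
    refine this.congr fun x => ?_
    ring
  have := integral_Ioi_of_hasDerivAt_of_tendsto' (a := 0) (f := fun x : ℝ => -((x : ℂ) / a + 1 / a ^ 2) * Complex.exp (-a * x)) (f' := fun x : ℝ => (x : ℂ) * Complex.exp (-a * x)) (m := 0) (fun x _ => ?_) hint hlim
  · rw [this]
    have h : a = -(2 * π * Complex.I) * (s + Complex.I) := by
      rw [ha]; linear_combination (2 * π : ℂ) * Complex.I_sq
    have h2 : a ^ 2 = -(4 * π ^ 2 * ((s : ℂ) + Complex.I) ^ 2) := by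
      rw [h]; linear_combination (4 * π ^ 2 * ((s : ℂ) + Complex.I) ^ 2) * Complex.I_sq
    simp [h2]
  · have h0 : HasDerivAt (fun s : ℝ => (s : ℂ)) 1 x := Complex.ofRealCLM.hasDerivAt
    have h3 := (((h0.div_const a).add_const (1 / a ^ 2)).neg).mul (h0.const_mul (-a)).cexp
    refine h3.congr_deriv ?_
    simp only [Pi.neg_apply]
    field_simp
    ring

/-- one-sided function -/
def gg (x : ℝ) : ℂ := Set.indicator (Set.Ioi (0:ℝ)) (fun x : ℝ => (x : ℂ) * Complex.exp (-(2 * π) * x)) x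

open FourierTransform in
lemma aux_finv (s : ℝ) : 𝓕⁻ gg s = -(4 * π ^ 2 * ((s : ℂ) + Complex.I) ^ 2)⁻¹ := by
  rw [Real.fourierInv_eq_fourier_neg, Real.fourier_real_eq_integral_exp_smul, ← aux_ft,
    ← integral_indicator measurableSet_Ioi]
  congr 1
  ext x
  unfold gg
  by_cases hx : x ∈ Set.Ioi (0:ℝ)
  · simp only [Set.indicator_of_mem hx, smul_eq_mul]
    rw [mul_left_comm, ← Complex.exp_add]
    congr 2
    push_cast; ring
  · simp [Set.indicator_of_notMem hx]

lemma aux_int2 : Integrable fun s : ℝ => -(4 * (π:ℂ) ^ 2 * ((s : ℂ) + Complex.I) ^ 2)⁻¹ := by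
  refine Integrable.neg ?_
  have : (fun s : ℝ => (4 * (π:ℂ) ^ 2 * ((s : ℂ) + Complex.I) ^ 2)⁻¹) = fun s : ℝ => (4 * (π:ℂ) ^ 2)⁻¹ * (((s : ℂ) + Complex.I) ^ 2)⁻¹ := by
    ext s; rw [mul_inv]
  rw [this]
  refine Integrable.const_mul ?_ _
  refine integrable_inv_one_add_sq.mono' (Continuous.inv₀ (by fun_prop) fun s => pow_ne_zero _ (aux_ne s)).aestronglyMeasurable ?_
  refine ae_of_all _ fun s => ?_
  rw [norm_inv, norm_pow, ← Complex.normSq_eq_norm_sq]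
  simp [Complex.normSq_apply]
  apply le_of_eq; ring

open FourierTransform in
lemma aux_J1 (t : ℝ) (ht : 0 < t) :
    Tendsto (JJ t 1) atTop (nhds (-(4 * π ^ 2) * t * Complex.exp (-(2 * π) * t))) := by
  have hg : Integrable gg := by
    have := (integrable_indicator_iff (μ := volume) (f := fun x : ℝ => (x : ℂ) * Complex.exp (-(2 * π) * x)) (measurableSet_Ioi (a := (0:ℝ)))).2 ?_
    · exact this
    have := integrableOn_rpow_mul_exp_neg_mul_rpow (s := 1) (p := 1) (b := 2 * π) (by norm_num) (by norm_num) (by positivity)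
    refine Integrable.mono' this (by fun_prop) ?_
    filter_upwards [ae_restrict_mem measurableSet_Ioi] with x hx
    rw [norm_mul, Complex.norm_exp]
    simp [abs_of_pos (Set.mem_Ioi.1 hx)]
  have hinv : 𝓕⁻ gg = fun s : ℝ => -(4 * (π:ℂ) ^ 2 * ((s : ℂ) + Complex.I) ^ 2)⁻¹ := funext aux_finv
  have hF : Integrable (𝓕 gg) := by
    have : 𝓕 gg = fun s => 𝓕⁻ gg (-s) := by
      ext s; rw [Real.fourierInv_eq_fourier_neg, neg_neg]
    rw [this, hinv]
    exact aux_int2.comp_neg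
  have hev : gg =ᶠ[nhds t] fun x : ℝ => (x : ℂ) * Complex.exp (-(2 * π) * x) := by
    filter_upwards [Ioi_mem_nhds ht] with x hx
    exact Set.indicator_of_mem hx _
  have hc : ContinuousAt gg t := by
    refine ContinuousAt.congr ?_ hev.symm
    fun_prop
  have key := hg.fourier_fourierInv_eq hF hc
  rw [hinv, Real.fourier_real_eq_integral_exp_smul, hev.self_of_nhds] at key
  beta_reduce at key
  have hpi : (π : ℂ) ≠ 0 := by exact_mod_cast Real.pi_ne_zero
  have hI : Integrable fun s : ℝ =>
      Complex.exp (-(2 * (π : ℂ) * (s : ℂ) * (t : ℂ)) * Complex.I) * (((s : ℂ) + Complex.I) ^ 2)⁻¹ := by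
    have := aux_int2.const_mul (-(4 * (π:ℂ)^2))
    refine Integrable.mono this (aux_cont t 1).aestronglyMeasurable (ae_of_all _ fun s => ?_)
    rw [norm_mul, aux_norm, one_mul]
    apply le_of_eq
    congr 1
    have := aux_ne s
    field_simp
  have := intervalIntegral_tendsto_integral hI tendsto_neg_atTop_atBot tendsto_id
  refine (this.congr fun R => rfl).trans (le_of_eq ?_)
  congr 1
  rw [mul_assoc, ← key, ← integral_const_mul]
  congr 1
  ext s
  have := aux_ne s
  rw [smul_eq_mul]
  have e : Complex.exp (((-2 * π * s * t : ℝ) : ℂ) * Complex.I) = Complex.exp (-(2 * (π : ℂ) * (s : ℂ) * (t : ℂ)) * Complex.I) := by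
    congr 1; push_cast; ring
  rw [e]
  field_simp

lemma aux_bd2 (t : ℝ) (k : ℕ) : Tendsto (fun R : ℝ => (-(2 * π * t) * Complex.I) * JJ t k R - (k + 1) * JJ t (k+1) R) atTop (nhds 0) := by
  have h1 := aux_bdry t k atTop tendsto_abs_atTop_atTop
  have h2 := (aux_bdry t k atBot tendsto_abs_atBot_atTop).comp tendsto_neg_atTop_atBot
  have := h1.sub h2
  rw [sub_zero] at this
  exact this.congr fun R => aux_ibp t k R

lemma aux_J (t : ℝ) (ht : 0 < t) (k : ℕ) :
    Tendsto (JJ t k) atTop (nhds (-(2 * π * Complex.I) * (-(2 * π * t) * Complex.I) ^ k / (k.factorial : ℂ) * Complex.exp (-(2 * π) * t))) := by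
  have hpi : (π : ℂ) ≠ 0 := by exact_mod_cast Real.pi_ne_zero
  have ht' : (t : ℂ) ≠ 0 := by exact_mod_cast ht.ne'
  have hc : (-(2 * π * t) * Complex.I : ℂ) ≠ 0 := by simp [hpi, ht']
  induction k with
  | zero =>
    have h := ((aux_bd2 t 0).add (aux_J1 t ht)).const_mul (-(2 * π * t) * Complex.I : ℂ)⁻¹
    refine (h.congr fun R => ?_).trans (le_of_eq ?_)
    · simp only [Nat.cast_zero, zero_add, one_mul, sub_add_cancel]
      rw [inv_mul_cancel_left₀ hc]
    · congr 1
      rw [zero_add, inv_mul_eq_iff_eq_mul₀ hc]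
      simp
      linear_combination (-4 * π ^ 2 * t * Complex.exp (-(2 * π * t)) : ℂ) * Complex.I_sq
  | succ k ih =>
    have hk : (k + 1 : ℂ) ≠ 0 := by exact_mod_cast Nat.succ_ne_zero k
    have hf : (k.factorial : ℂ) ≠ 0 := by exact_mod_cast k.factorial_ne_zero
    have h := ((ih.const_mul (-(2 * π * t) * Complex.I : ℂ)).sub (aux_bd2 t k)).const_mul (k + 1 : ℂ)⁻¹
    refine (h.congr fun R => ?_).trans (le_of_eq ?_)
    · rw [sub_sub_cancel, inv_mul_cancel_left₀ hk]
    · congr 1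
      rw [sub_zero, Nat.factorial_succ, pow_succ]
      push_cast
      field_simp

/-- For every `n ≥ 0` and `t > 0`,
`∫_ℝ e^{−2πist} (1/√π) ((s−i)/(s+i))^n (s+i)^{−1} ds = −2√π i L_n(4πt) e^{−2πt}`,
the (conditionally convergent) integral being understood as the limit of the integrals
over `[−R, R]` as `R → ∞`. -/
theorem fourier_transform_of_laguerre_basis
    (n : ℕ) (t : ℝ) (ht : 0 < t) :
    Tendsto
      (fun R : ℝ => ∫ s in (-R)..R,
        Complex.exp (-(2 * (π : ℂ) * (s : ℂ) * (t : ℂ)) * Complex.I) *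
          ((1 / Real.sqrt π : ℝ) : ℂ) *
          (((s : ℂ) - Complex.I) / ((s : ℂ) + Complex.I)) ^ n *
          ((s : ℂ) + Complex.I)⁻¹)
      atTop
      (nhds (-2 * ((Real.sqrt π : ℝ) : ℂ) * Complex.I *
        ((laguerre n (4 * π * t) : ℝ) : ℂ) * ((Real.exp (-(2 * π * t)) : ℝ) : ℂ))) := by
  have h := (tendsto_finsetSum (Finset.range (n+1)) fun k _ =>
    (aux_J t ht k).const_mul ((n.choose k : ℂ) * (-2 * Complex.I) ^ k)).const_mul ((1 / Real.sqrt π : ℝ) : ℂ)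
  refine (h.congr fun R => ?_).trans (le_of_eq ?_)
  · unfold JJ
    simp only [← intervalIntegral.integral_const_mul]
    rw [← intervalIntegral.integral_finsetSum fun k _ => ((aux_cont t k).intervalIntegrable _ _).const_mul _,
      ← intervalIntegral.integral_const_mul]
    congr 1
    ext s
    have hs := aux_ne s
    have e : ((s : ℂ) - Complex.I) / ((s : ℂ) + Complex.I) = (-2 * Complex.I) * ((s : ℂ) + Complex.I)⁻¹ + 1 := by
      field_simp; ring
    rw [e, add_pow]
    simp only [Finset.mul_sum, Finset.sum_mul]
    refine Finset.sum_congr rfl fun k _ => ?_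
    rw [mul_pow (-2 * Complex.I) ((s : ℂ) + Complex.I)⁻¹, pow_succ, mul_inv, inv_pow, one_pow]
    ring
  · congr 1
    rw [aux_lag]
    push_cast
    have e : Complex.exp (-(2 * π) * t) = Complex.exp (-(2 * π * t)) := by congr 1; ring
    have hsq : ((Real.sqrt π : ℝ) : ℂ) * ((Real.sqrt π : ℝ) : ℂ) = π := by
      rw [← Complex.ofReal_mul, Real.mul_self_sqrt Real.pi_pos.le]
    have hs0 : ((Real.sqrt π : ℝ) : ℂ) ≠ 0 := by
      exact_mod_cast (Real.sqrt_pos.2 Real.pi_pos).ne'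
    have hq : (1 / ((Real.sqrt π : ℝ) : ℂ)) * π = ((Real.sqrt π : ℝ) : ℂ) := by
      rw [← hsq]; field_simp
    rw [e]
    simp only [Finset.mul_sum, Finset.sum_mul]
    refine Finset.sum_congr rfl fun k _ => ?_
    have hp : (-2 * Complex.I) ^ k * (-(2 * π * t) * Complex.I) ^ k = (-(4 * π * t : ℂ)) ^ k := by
      rw [← mul_pow]; congr 1
      linear_combination (4 * π * t : ℂ) * Complex.I_sq
    rw [← hp]
    nth_rewrite 2 [← hq]
    ring

end
end
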